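/- arXiv:2208.05166 — 12 statements merged into one kernel-verified Lean document; each statement's English description precedes it below -/
import Mathlib

section
/- Let ρ > 0 and σ > 0, and let f : ℕ → ℝ satisfy Σ_{n=0}^∞ f_n² π_n(σ) < ∞. Then the series Σ_{n=0}^∞ (ρ^n/n!) f_n f_{n+1} converges absolutely and satisfies (2ρ/(σ+ρ)) · |Σ_{n=0}^∞ (ρ^n/n!) f_n f_{n+1}| ≤ 2√(ρ/(σ+ρ)) · Σ_{n=0}^∞ f_n² π_n(σ). (This is the bound showing that the tridiagonal operator A(σ) of the absorbed M/M/∞ chain is bounded with norm at most 2√(ρ/(σ+ρ)) on the weighted ℓ² space with weights π_n(σ).) -/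
/-- The weights `π_n(σ) = ((σ+ρ+n)/(σ+ρ)) · ρ^n/n!`. -/
noncomputable def weightPi (ρ σ : ℝ) (n : ℕ) : ℝ :=
  (σ + ρ + n) / (σ + ρ) * ρ ^ n / n.factorial

theorem weightPi_eq_add {ρ σ : ℝ} (h : σ + ρ ≠ 0) (n : ℕ) :
    weightPi ρ σ n = ρ ^ n / n.factorial + n * (ρ ^ n / n.factorial) / (σ + ρ) := by
  unfold weightPi
  field_simp

theorem succ_mul_pow_succ_div_factorial (ρ : ℝ) (n : ℕ) :
    ((n + 1 : ℕ) : ℝ) * (ρ ^ (n + 1) / (n + 1).factorial) = ρ * (ρ ^ n / n.factorial) := by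
  rw [Nat.factorial_succ]
  push_cast
  field_simp
  ring

/-- boundedness estimate for the tridiagonal operator `A(σ)`. -/
theorem abs_tsum_weighted_shift_le (ρ σ : ℝ) (hρ : 0 < ρ) (hσ : 0 < σ) (f : ℕ → ℝ)
    (hf : Summable fun n : ℕ => f n ^ 2 * weightPi ρ σ n) :
    Summable (fun n : ℕ => |ρ ^ n / n.factorial * (f n * f (n + 1))|) ∧
      2 * ρ / (σ + ρ) * |∑' n : ℕ, ρ ^ n / n.factorial * (f n * f (n + 1))| ≤
        2 * Real.sqrt (ρ / (σ + ρ)) * ∑' n : ℕ, f n ^ 2 * weightPi ρ σ n := by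
  have hS : 0 < σ + ρ := by positivity
  set s := Real.sqrt (ρ / (σ + ρ))
  have hs0 : 0 < s := Real.sqrt_pos.2 (by positivity)
  have hs2 : s ^ 2 = ρ / (σ + ρ) := Real.sq_sqrt (by positivity)
  let g : ℕ → ℝ := fun n => f n ^ 2 * (ρ ^ n / n.factorial)
  let h : ℕ → ℝ := fun n => f n ^ 2 * (n * (ρ ^ n / n.factorial) / (σ + ρ))
  have hg0 : ∀ n, 0 ≤ g n := fun n => by positivity
  have hh0 : ∀ n, 0 ≤ h n := fun n => by positivity
  have hgh : ∀ n, f n ^ 2 * weightPi ρ σ n = g n + h n := fun n => by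
    rw [weightPi_eq_add hS.ne', mul_add]
  simp only [hgh] at hf ⊢
  have hg : Summable g := hf.of_nonneg_of_le hg0 fun n => le_add_of_nonneg_right (hh0 n)
  have hh : Summable h := hf.of_nonneg_of_le hh0 fun n => le_add_of_nonneg_left (hg0 n)
  have hh' : Summable fun n => h (n + 1) := (summable_nat_add_iff 1).2 hh
  have key : ∀ n : ℕ, 2 * s ^ 2 * |ρ ^ n / n.factorial * (f n * f (n + 1))| ≤
      s * (g n + h (n + 1)) := fun n => by
    have hw : 0 ≤ ρ ^ n / n.factorial := by positivity
    have hsucc : h (n + 1) = s ^ 2 * f (n + 1) ^ 2 * (ρ ^ n / n.factorial) := by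
      simp only [h]
      rw [succ_mul_pow_succ_div_factorial, hs2]
      ring
    rw [hsucc, abs_mul, abs_of_nonneg hw, abs_mul]
    simp only [g]
    rw [← sq_abs (f n), ← sq_abs (f (n + 1))]
    have := mul_nonneg (mul_nonneg hs0.le hw) (sq_nonneg (|f n| - s * |f (n + 1)|))
    linarith
  have hsum : Summable fun n : ℕ => |ρ ^ n / n.factorial * (f n * f (n + 1))| := by
    have : Summable fun n : ℕ => 2 * s ^ 2 * |ρ ^ n / n.factorial * (f n * f (n + 1))| :=
      ((hg.add hh').mul_left s).of_nonneg_of_le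
        (fun n => mul_nonneg (by positivity) (abs_nonneg _)) key
    exact (summable_mul_left_iff (by positivity : 2 * s ^ 2 ≠ 0)).1 this
  refine ⟨hsum, ?_⟩
  have htail : ∑' n, h (n + 1) = ∑' n, h n := by
    rw [hh.tsum_eq_zero_add]
    simp [h]
  have habs : |∑' n : ℕ, ρ ^ n / n.factorial * (f n * f (n + 1))| ≤
      ∑' n : ℕ, |ρ ^ n / n.factorial * (f n * f (n + 1))| := by
    simpa only [Real.norm_eq_abs] using norm_tsum_le_tsum_norm
      (f := fun n : ℕ => ρ ^ n / n.factorial * (f n * f (n + 1))) hsum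
  calc 2 * ρ / (σ + ρ) * |∑' n : ℕ, ρ ^ n / n.factorial * (f n * f (n + 1))|
      = 2 * s ^ 2 * |∑' n : ℕ, ρ ^ n / n.factorial * (f n * f (n + 1))| := by
        rw [hs2, mul_div_assoc]
    _ ≤ 2 * s ^ 2 * ∑' n : ℕ, |ρ ^ n / n.factorial * (f n * f (n + 1))| := by gcongr
    _ = ∑' n : ℕ, 2 * s ^ 2 * |ρ ^ n / n.factorial * (f n * f (n + 1))| := tsum_mul_left.symm
    _ ≤ ∑' n, s * (g n + h (n + 1)) :=
        (hsum.mul_left _).tsum_le_tsum key ((hg.add hh').mul_left s)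
    _ = s * ∑' n, (g n + h n) := by
        rw [tsum_mul_left, hg.tsum_add hh', hg.tsum_add hh, htail]
    _ ≤ 2 * s * ∑' n, (g n + h n) := by
        have : 0 ≤ ∑' n, (g n + h n) := tsum_nonneg fun n => add_nonneg (hg0 n) (hh0 n)
        gcongr
        linarith
end

section
/- Let ρ > 0 and σ > 0. For every real x ≠ 0 and every n ≥ 0, one has P_n(σ;x) = x^{−n} · C_n((ρ − (σ+ρ)x²)/x² ; ρ/x²) and P*_n(σ;x) = −(σ+ρ) · x^{−(n+1)} · C*_n((ρ − (σ+ρ)x²)/x² ; ρ/x²). -/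
/-- Charlier polynomials `C_n(x;a)`: `C_0 = 1` and
`a·C_{n+1} + (x−n−a)·C_n + n·C_{n−1} = 0`. -/
noncomputable def charlier (a x : ℝ) : ℕ → ℝ
  | 0 => 1
  | 1 => (a - x) / a
  | n + 2 => (((n : ℝ) + 1 + a - x) * charlier a x (n + 1) - ((n : ℝ) + 1) * charlier a x n) / a

/-- Charlier polynomials of the second kind `C*_n(x;a)`: `C*_0 = 0`, `C*_1 = −1/a`, same
recurrence as `charlier` for `n ≥ 1`. -/
noncomputable def charlierStar (a x : ℝ) : ℕ → ℝ
  | 0 => 0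
  | 1 => -1 / a
  | n + 2 =>
      (((n : ℝ) + 1 + a - x) * charlierStar a x (n + 1) - ((n : ℝ) + 1) * charlierStar a x n) / a

/-- The polynomials `P_n(σ;x)`: `P_0 = 1` and
`ρ·P_{n+1} − (n+σ+ρ)·x·P_n + n·P_{n−1} = 0`. -/
noncomputable def Ppoly (ρ σ x : ℝ) : ℕ → ℝ
  | 0 => 1
  | 1 => (σ + ρ) * x / ρ
  | n + 2 =>
      (((n : ℝ) + 1 + σ + ρ) * x * Ppoly ρ σ x (n + 1) - ((n : ℝ) + 1) * Ppoly ρ σ x n) / ρ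

/-- The polynomials of the second kind `P*_n(σ;x)`: `P*_0 = 0`, `P*_1 = (σ+ρ)/ρ`, same
recurrence as `Ppoly` for `n ≥ 1`. -/
noncomputable def PpolyStar (ρ σ x : ℝ) : ℕ → ℝ
  | 0 => 0
  | 1 => (σ + ρ) / ρ
  | n + 2 =>
      (((n : ℝ) + 1 + σ + ρ) * x * PpolyStar ρ σ x (n + 1) - ((n : ℝ) + 1) * PpolyStar ρ σ x n) / ρ

/-- the polynomials `P_n(σ;·)` and `P*_n(σ;·)` are rescaled Charlier polynomials
(of the first and second kind). -/
theorem Ppoly_eq_charlier (ρ σ : ℝ) (hρ : 0 < ρ) (hσ : 0 < σ) (x : ℝ) (hx : x ≠ 0) (n : ℕ) :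
    Ppoly ρ σ x n =
      (x ^ n)⁻¹ * charlier (ρ / x ^ 2) ((ρ - (σ + ρ) * x ^ 2) / x ^ 2) n ∧
    PpolyStar ρ σ x n =
      -(σ + ρ) * (x ^ (n + 1))⁻¹ * charlierStar (ρ / x ^ 2) ((ρ - (σ + ρ) * x ^ 2) / x ^ 2) n := by
  have hρ' : ρ ≠ 0 := hρ.ne'
  have hsub : (ρ - (σ + ρ) * x ^ 2) / x ^ 2 = ρ / x ^ 2 - (σ + ρ) := by field_simp
  rw [hsub]
  induction n using Nat.twoStepInduction with
  | zero => simp [Ppoly, PpolyStar, charlier, charlierStar]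
  | one =>
    simp only [Ppoly, PpolyStar, charlier, charlierStar]
    exact ⟨by field_simp; ring, by field_simp⟩
  | more n ih₀ ih₁ =>
    simp only [Ppoly, PpolyStar, charlier, charlierStar]
    rw [ih₀.1, ih₀.2, ih₁.1, ih₁.2]
    exact ⟨by field_simp; ring, by field_simp; ring⟩
end

section
/- Let ρ > 0 and σ > 0, and define χ(σ;x) = ((σ+ρ)/(x·(ρ+σ−ρ/x²))) · Φ(1, ρ+σ−ρ/x²+1; −ρ/x²) for real x > 0 such that ρ+σ−ρ/x² is not a nonpositive integer. Then for every k ∈ ℕ, the function χ(σ;·) has a simple pole at s_k(σ) = √(ρ/(σ+ρ+k)) with residue r_k(σ); that is, lim_{x → s_k(σ), x ≠ s_k(σ)} (x − s_k(σ)) · χ(σ;x) = r_k(σ) = ((σ+ρ)/(2(σ+ρ+k))) · ((σ+ρ+k)^k/k!) · e^{−(σ+ρ+k)}. -/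
/-- The Kummer confluent hypergeometric function
`Φ(α,β;z) = Σ_{n=0}^∞ ((α)_n/(β)_n) · z^n/n!`. -/
noncomputable def kummerPhi (α β z : ℝ) : ℝ :=
  ∑' n : ℕ, ((ascPochhammer ℝ n).eval α / (ascPochhammer ℝ n).eval β) * z ^ n / n.factorial

open Filter Topology

theorem kummerPhi_one_left (b z : ℝ) :
    kummerPhi 1 b z = ∑' n : ℕ, z ^ n / (ascPochhammer ℝ n).eval b := by
  unfold kummerPhi
  congr 1 with n
  have : (n.factorial : ℝ) ≠ 0 := by positivity
  rw [ascPochhammer_eval_one]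
  field_simp

theorem summable_pow_div_ascPochhammer (b z : ℝ) :
    Summable fun n : ℕ => z ^ n / (ascPochhammer ℝ n).eval b := by
  refine summable_of_ratio_norm_eventually_le (r := 1 / 2) (by norm_num) ?_
  have h : Tendsto (fun n : ℕ => b + (n : ℝ)) atTop atTop :=
    tendsto_atTop_add_const_left _ _ tendsto_natCast_atTop_atTop
  filter_upwards [h.eventually_ge_atTop (2 * |z| + 1)] with n hn
  have hz := abs_nonneg z
  have hpos : 0 < b + n := by linarith
  rw [ascPochhammer_succ_eval, pow_succ, mul_div_mul_comm, norm_mul, mul_comm]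
  gcongr
  rw [norm_div, Real.norm_eq_abs, Real.norm_eq_abs, abs_of_pos hpos, div_le_iff₀ hpos]
  linarith

theorem kummerPhi_one_left_eq (b z : ℝ) :
    kummerPhi 1 b z = 1 + z / b * kummerPhi 1 (b + 1) z := by
  rw [kummerPhi_one_left, kummerPhi_one_left,
    (summable_pow_div_ascPochhammer b z).tsum_eq_zero_add, ← tsum_mul_left]
  congr 1
  · simp
  · congr 1 with n
    rw [ascPochhammer_succ_left, Polynomial.eval_mul, Polynomial.eval_X, Polynomial.eval_comp,
      Polynomial.eval_add, Polynomial.eval_X, Polynomial.eval_one, pow_succ', mul_div_mul_comm]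

theorem factorial_div_two_pow_le_ascPochhammer_eval {b : ℝ} (hb : 1 / 2 ≤ b) (n : ℕ) :
    (n.factorial : ℝ) / 2 ^ n ≤ (ascPochhammer ℝ n).eval b := by
  induction n with
  | zero => simp
  | succ n ih =>
    have hn : (0 : ℝ) ≤ n := n.cast_nonneg
    rw [ascPochhammer_succ_eval, Nat.factorial_succ, Nat.cast_mul, pow_succ,
      mul_comm ((n + 1 : ℕ) : ℝ), mul_div_mul_comm]
    refine mul_le_mul ih ?_ (by positivity) (le_trans (by positivity) ih)
    push_cast
    linarith

theorem tendsto_kummerPhi_one_one {X : Type*} {l : Filter X} {b z : X → ℝ} {w : ℝ}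
    (hb : Tendsto b l (𝓝 1)) (hz : Tendsto z l (𝓝 w)) :
    Tendsto (fun x => kummerPhi 1 (b x) (z x)) l (𝓝 (Real.exp w)) := by
  simp only [kummerPhi_one_left]
  rw [Real.exp_eq_exp_ℝ, NormedSpace.exp_eq_tsum_div]
  refine tendsto_tsum_of_dominated_convergence
    (bound := fun n : ℕ => (2 * (|w| + 1)) ^ n / n.factorial)
    (Real.summable_pow_div_factorial _) (fun n => ?_) ?_
  · have h := (hz.pow n).div (((ascPochhammer ℝ n).continuous.tendsto 1).comp hb)
      (by rw [ascPochhammer_eval_one]; positivity)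
    rwa [ascPochhammer_eval_one] at h
  · filter_upwards [hb.eventually_const_le (show (1 / 2 : ℝ) < 1 by norm_num),
      hz.abs.eventually_le_const (show |w| < |w| + 1 by linarith)] with x hbx hzx n
    have h := factorial_div_two_pow_le_ascPochhammer_eval hbx n
    have hpos : (0 : ℝ) < n.factorial / 2 ^ n := by positivity
    rw [norm_div, norm_pow, Real.norm_eq_abs, Real.norm_eq_abs, abs_of_pos (hpos.trans_le h)]
    calc |z x| ^ n / (ascPochhammer ℝ n).eval (b x)
        ≤ (|w| + 1) ^ n / (n.factorial / 2 ^ n) := by gcongr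
      _ = (2 * (|w| + 1)) ^ n / n.factorial := by rw [mul_pow]; field_simp

theorem tendsto_add_natCast_mul_kummerPhi_one_div {X : Type*} {l : Filter X} {t : X → ℝ} {c : ℝ}
    (ht : Tendsto t l (𝓝 c)) (k : ℕ) {a : X → ℝ} (ha : Tendsto a l (𝓝 (-(k : ℝ))))
    (hne : ∀ᶠ x in l, a x ≠ -(k : ℝ)) :
    Tendsto (fun x => (a x + k) * (kummerPhi 1 (a x + 1) (-t x) / a x)) l
      (𝓝 (c ^ k / k.factorial * Real.exp (-c))) := by
  induction k generalizing a with
  | zero =>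
    simp only [Nat.cast_zero, neg_zero] at ha hne
    have h := tendsto_kummerPhi_one_one (by simpa using ha.add_const 1) ht.neg
    simp only [pow_zero, Nat.factorial_zero, Nat.cast_one, div_one, one_mul]
    refine h.congr' ?_
    filter_upwards [hne] with x hx
    simp [mul_div_cancel₀ _ hx]
  | succ k ih =>
    push_cast at ha hne
    have ha' : Tendsto (fun x => a x + 1) l (𝓝 (-(k : ℝ))) := by
      convert ha.add_const 1 using 2
      ring
    have h := ih ha' (hne.mono fun x hx h => hx (by linarith))
    have hk : (k : ℝ) + 1 ≠ 0 := by positivity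
    have hk' : -((k : ℝ) + 1) ≠ 0 := neg_ne_zero.mpr hk
    have h' := ((ha.add_const ((k : ℝ) + 1)).div ha hk').add ((ht.neg.div ha hk').mul h)
    convert h' using 2 with x
    · rw [kummerPhi_one_left_eq (a x + 1)]
      simp only [Pi.div_apply]
      push_cast
      ring
    · rw [Nat.factorial_succ]
      push_cast
      field_simp
      ring

/-- the continued fraction `χ(σ;x)`, defined for `x > 0` with `ρ+σ−ρ/x²` not a
nonpositive integer, has a simple pole at `s_k(σ) = √(ρ/(σ+ρ+k))` with residue
`r_k(σ) = ((σ+ρ)/(2(σ+ρ+k))) · ((σ+ρ+k)^k/k!) · e^{−(σ+ρ+k)}`. -/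
theorem chi_residue_at_sk (ρ σ : ℝ) (hρ : 0 < ρ) (hσ : 0 < σ) (k : ℕ) :
    Filter.Tendsto
      (fun x : ℝ =>
        (x - Real.sqrt (ρ / (σ + ρ + k))) *
          ((σ + ρ) / (x * (ρ + σ - ρ / x ^ 2)) *
            kummerPhi 1 (ρ + σ - ρ / x ^ 2 + 1) (-(ρ / x ^ 2))))
      (nhdsWithin (Real.sqrt (ρ / (σ + ρ + k)))
        {x : ℝ | x ≠ Real.sqrt (ρ / (σ + ρ + k)) ∧ 0 < x ∧
          ∀ n : ℕ, ρ + σ - ρ / x ^ 2 ≠ -(n : ℝ)})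
      (nhds ((σ + ρ) / (2 * (σ + ρ + k)) * ((σ + ρ + k) ^ k / k.factorial) *
        Real.exp (-(σ + ρ + k)))) := by
  set c : ℝ := σ + ρ + k with hc
  have hcpos : 0 < c := by positivity
  set s : ℝ := Real.sqrt (ρ / c) with hs
  have hspos : 0 < s := Real.sqrt_pos.mpr (by positivity)
  have hs2 : s ^ 2 = ρ / c := Real.sq_sqrt (by positivity)
  have hsq : c * s ^ 2 = ρ := by rw [hs2]; field_simp
  set S : Set ℝ := {x | x ≠ s ∧ 0 < x ∧ ∀ n : ℕ, ρ + σ - ρ / x ^ 2 ≠ -(n : ℝ)}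
  have hx : Tendsto (fun x : ℝ => x) (𝓝[S] s) (𝓝 s) := tendsto_id.mono_left nhdsWithin_le_nhds
  have ht : Tendsto (fun x : ℝ => ρ / x ^ 2) (𝓝[S] s) (𝓝 c) := by
    have h := (tendsto_const_nhds (x := ρ)).div (hx.pow 2) (by positivity)
    rwa [← hsq, mul_div_assoc, div_self (by positivity), mul_one, hsq] at h
  have ha : Tendsto (fun x : ℝ => ρ + σ - ρ / x ^ 2) (𝓝[S] s) (𝓝 (-(k : ℝ))) := by
    convert ht.const_sub (ρ + σ) using 2
    rw [hc]; ring
  have hmem : ∀ᶠ x in 𝓝[S] s, x ∈ S := self_mem_nhdsWithin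
  have h := tendsto_add_natCast_mul_kummerPhi_one_div ht k ha (hmem.mono fun x hx => hx.2.2 k)
  have hfactor : Tendsto (fun x : ℝ => (σ + ρ) * x / (c * (x + s))) (𝓝[S] s)
      (𝓝 ((σ + ρ) / (2 * c))) := by
    have hlim : (σ + ρ) / (2 * c) = (σ + ρ) * s / (c * (s + s)) := by
      field_simp
      ring
    rw [hlim]
    exact (hx.const_mul (σ + ρ)).div ((hx.add_const s).const_mul c) (by positivity)
  rw [mul_assoc]
  refine (hfactor.mul h).congr' ?_
  filter_upwards [hmem] with x ⟨hxs, hx0, hxn⟩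
  have hxs' : x + s ≠ 0 := by positivity
  have hak : ρ + σ - ρ / x ^ 2 + k = c * (x - s) * (x + s) / x ^ 2 := by
    have : ρ + σ - ρ / x ^ 2 + k = c - ρ / x ^ 2 := by rw [hc]; ring
    rw [this]
    field_simp
    linear_combination hsq
  rw [hak]
  have hane : ρ + σ - ρ / x ^ 2 ≠ 0 := by simpa using hxn 0
  generalize kummerPhi 1 (ρ + σ - ρ / x ^ 2 + 1) (-(ρ / x ^ 2)) = P
  generalize ρ + σ - ρ / x ^ 2 = a at hane ⊢
  field_simp
end

section
/- Let ρ > 0 and σ > 0. For all n, m ∈ ℕ, the series Σ_{k=0}^∞ r_k(σ) · [P_n(σ; s_k(σ)) · P_m(σ; s_k(σ)) + P_n(σ; −s_k(σ)) · P_m(σ; −s_k(σ))] converges and equals 1/π_n(σ) if n = m and 0 otherwise. (These are the orthogonality relations of the polynomials P_n(σ;·) with respect to the discrete spectral measure of the operator A(σ), which has atoms at ±s_k(σ) with mass r_k(σ).) -/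
/-- The atoms `s_k(σ) = √(ρ/(σ+ρ+k))` of the spectral measure. -/
noncomputable def atomS (ρ σ : ℝ) (k : ℕ) : ℝ := Real.sqrt (ρ / (σ + ρ + k))

/-- The masses `r_k(σ) = ((σ+ρ)/(2(σ+ρ+k))) · ((σ+ρ+k)^k/k!) · e^{−(σ+ρ+k)}`. -/
noncomputable def massR (ρ σ : ℝ) (k : ℕ) : ℝ :=
  (σ + ρ) / (2 * (σ + ρ + k)) * ((σ + ρ + k) ^ k / k.factorial) * Real.exp (-(σ + ρ + k))

open Filter Topology MeasureTheory intervalIntegral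

/-- The terms `a (a+k)^(k-1) e^{-(a+k)} / k!` of the Borel–Tanner distribution, written so that
they make sense at `a = 0`. -/
noncomputable def borelTerm : ℕ → ℝ → ℝ
  | 0, a => Real.exp (-a)
  | k + 1, a => a * (a + (k + 1)) ^ k / (k + 1).factorial * Real.exp (-(a + (k + 1)))

/-- Partial sums of `borelTerm`. -/
noncomputable def borelSum (K : ℕ) (a : ℝ) : ℝ := ∑ k ∈ Finset.range K, borelTerm k a

lemma borelTerm_nonneg (k : ℕ) {a : ℝ} (ha : 0 ≤ a) : 0 ≤ borelTerm k a := by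
  cases k <;> simp only [borelTerm] <;> positivity

lemma hasDerivAt_borelTerm_zero (a : ℝ) :
    HasDerivAt (borelTerm 0) (-borelTerm 0 a) a :=
  (hasDerivAt_neg a).exp.congr_deriv (by simp [borelTerm])

lemma hasDerivAt_borelTerm_succ (k : ℕ) (a : ℝ) :
    HasDerivAt (borelTerm (k + 1)) (borelTerm k (a + 1) - borelTerm (k + 1) a) a := by
  have h1 : HasDerivAt (fun x : ℝ => x + ((k : ℝ) + 1)) 1 a := (hasDerivAt_id a).add_const _
  have h2 := (((hasDerivAt_id a).mul (h1.pow k)).div_const ((k + 1).factorial : ℝ)).mul h1.neg.exp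
  refine h2.congr_deriv ?_
  have hf : ((k.factorial : ℕ) : ℝ) ≠ 0 := by positivity
  cases k with
  | zero =>
    simp [borelTerm]
    ring
  | succ j =>
    have e : -(a + 1 + ((j : ℝ) + 1)) = -(a + ((j + 1 : ℕ) + 1)) := by push_cast; ring
    have hj : ((j + 1 : ℕ) : ℝ) + 1 ≠ 0 := by positivity
    simp only [borelTerm, e]
    simp only [Nat.factorial_succ (j + 1), id, Pi.pow_apply, Pi.mul_apply, Pi.neg_apply, Nat.add_sub_cancel]
    push_cast at *
    field_simp
    ring

lemma hasDerivAt_borelSum (K : ℕ) (a : ℝ) :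
    HasDerivAt (borelSum (K + 1)) (borelSum K (a + 1) - borelSum (K + 1) a) a := by
  induction K with
  | zero =>
    have e : borelSum (0 + 1) = borelTerm 0 := by ext x; simp [borelSum]
    rw [e]
    exact (hasDerivAt_borelTerm_zero a).congr_deriv (by simp [borelSum])
  | succ K ih =>
    have h := ih.add (hasDerivAt_borelTerm_succ K a)
    have e : borelSum (K + 1 + 1) = borelSum (K + 1) + borelTerm (K + 1) := by
      ext x; simp [borelSum, Finset.sum_range_succ]
    rw [e]
    refine h.congr_deriv ?_
    simp only [borelSum, Finset.sum_range_succ, Pi.add_apply]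
    ring

lemma continuous_borelSum (K : ℕ) : Continuous (borelSum K) := by
  cases K with
  | zero => exact (continuous_const (y := (0 : ℝ))).congr fun x => by simp [borelSum]
  | succ K => exact continuous_iff_continuousAt.2 fun a => (hasDerivAt_borelSum K a).continuousAt

lemma borelSum_succ_zero (K : ℕ) : borelSum (K + 1) 0 = 1 := by
  simp [borelSum, Finset.sum_range_succ', borelTerm]

lemma borelSum_nonneg (K : ℕ) {a : ℝ} (ha : 0 ≤ a) : 0 ≤ borelSum K a :=
  Finset.sum_nonneg fun k _ => borelTerm_nonneg k ha

lemma borelSum_le_one (K : ℕ) {a : ℝ} (ha : 0 ≤ a) : borelSum K a ≤ 1 := by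
  induction K generalizing a with
  | zero => simp [borelSum]
  | succ K ih =>
    have hd : ∀ x, HasDerivAt (fun x => Real.exp x * (1 - borelSum (K + 1) x))
        (Real.exp x * (1 - borelSum K (x + 1))) x := fun x =>
      ((Real.hasDerivAt_exp x).mul ((hasDerivAt_borelSum K x).const_sub 1)).congr_deriv (by ring)
    have hm : MonotoneOn (fun x => Real.exp x * (1 - borelSum (K + 1) x)) (Set.Ici 0) := by
      refine monotoneOn_of_deriv_nonneg (convex_Ici 0)
        (fun x _ => (hd x).continuousAt.continuousWithinAt)
        (fun x _ => (hd x).differentiableAt.differentiableWithinAt) fun x hx => ?_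
      rw [interior_Ici, Set.mem_Ioi] at hx
      rw [(hd x).deriv]
      exact mul_nonneg (Real.exp_pos x).le (sub_nonneg.2 (ih (by linarith)))
    have h := hm (Set.self_mem_Ici) (Set.mem_Ici.2 ha) ha
    simp only [borelSum_succ_zero, sub_self, mul_zero] at h
    linarith [nonneg_of_mul_nonneg_right h (Real.exp_pos a)]

lemma summable_borelTerm {a : ℝ} (ha : 0 ≤ a) : Summable fun k => borelTerm k a :=
  summable_of_sum_range_le (fun k => borelTerm_nonneg k ha) fun K => borelSum_le_one K ha

lemma tendsto_borelSum {a : ℝ} (ha : 0 ≤ a) :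
    Tendsto (fun K => borelSum K a) atTop (𝓝 (∑' k, borelTerm k a)) :=
  (summable_borelTerm ha).hasSum.tendsto_sum_nat

lemma tsum_borelTerm_le_one {a : ℝ} (ha : 0 ≤ a) : ∑' k, borelTerm k a ≤ 1 :=
  le_of_tendsto' (tendsto_borelSum ha) fun K => borelSum_le_one K ha

lemma continuousOn_tsum_borelTerm :
    ContinuousOn (fun a => ∑' k, borelTerm k a) (Set.Ici 0) := by
  refine LipschitzOnWith.continuousOn (K := 1) (LipschitzOnWith.of_dist_le_mul fun x hx y hy => ?_)
  have hx' : (0 : ℝ) ≤ x := hx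
  have hy' : (0 : ℝ) ≤ y := hy
  refine le_of_tendsto (((tendsto_borelSum hx').comp (tendsto_add_atTop_nat 1)).dist
    ((tendsto_borelSum hy').comp (tendsto_add_atTop_nat 1))) (Eventually.of_forall fun K => ?_)
  have hL : LipschitzOnWith 1 (borelSum (K + 1)) (Set.Ici 0) := by
    refine (convex_Ici 0).lipschitzOnWith_of_nnnorm_hasDerivWithin_le
      (fun z _ => (hasDerivAt_borelSum K z).hasDerivWithinAt) fun z hz => ?_
    have hz' : (0 : ℝ) ≤ z := hz
    rw [← NNReal.coe_le_coe, coe_nnnorm, Real.norm_eq_abs, NNReal.coe_one, abs_le]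
    have h1 := borelSum_nonneg K (by linarith : 0 ≤ z + 1)
    have h2 := borelSum_le_one K (by linarith : 0 ≤ z + 1)
    have h3 := borelSum_nonneg (K + 1) hz'
    have h4 := borelSum_le_one (K + 1) hz'
    constructor <;> linarith
  exact hL.dist_le_mul x hx y hy

lemma intervalIntegrable_tsum_borelTerm {a b : ℝ} (ha : 0 ≤ a) (hb : 0 ≤ b) :
    IntervalIntegrable (fun a => ∑' k, borelTerm k a) volume a b := by
  refine (continuousOn_tsum_borelTerm.mono fun x hx => ?_).intervalIntegrable
  exact (le_min ha hb).trans hx.1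

lemma tsum_borelTerm_sub_one {b : ℝ} (hb : 0 ≤ b) :
    ∑' k, borelTerm k b - 1 =
      (∫ s in b..(b + 1), ∑' k, borelTerm k s) - ∫ s in (0 : ℝ)..1, ∑' k, borelTerm k s := by
  have hK : ∀ K, borelSum (K + 1) b - 1 =
      ∫ s in (0 : ℝ)..b, (borelSum K (s + 1) - borelSum (K + 1) s) := fun K => by
    rw [integral_eq_sub_of_hasDerivAt (fun x _ => hasDerivAt_borelSum K x), borelSum_succ_zero]
    refine Continuous.intervalIntegrable ?_ _ _
    exact ((continuous_borelSum K).comp (continuous_id.add continuous_const)).sub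
      (continuous_borelSum (K + 1))
  have hlim : Tendsto (fun K => ∫ s in (0 : ℝ)..b, (borelSum K (s + 1) - borelSum (K + 1) s)) atTop
      (𝓝 (∫ s in (0 : ℝ)..b, (∑' k, borelTerm k (s + 1) - ∑' k, borelTerm k s))) := by
    refine tendsto_integral_filter_of_dominated_convergence (fun _ => 1)
      (Eventually.of_forall fun K => ?_)
      (Eventually.of_forall fun K => Eventually.of_forall fun s hs => ?_)
      intervalIntegrable_const (Eventually.of_forall fun s hs => ?_)
    · exact (((continuous_borelSum K).comp (continuous_id.add continuous_const)).sub
        (continuous_borelSum (K + 1))).aestronglyMeasurable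
    · rw [Set.uIoc_of_le hb] at hs
      have h1 := borelSum_nonneg K (by linarith [hs.1] : 0 ≤ s + 1)
      have h2 := borelSum_le_one K (by linarith [hs.1] : 0 ≤ s + 1)
      have h3 := borelSum_nonneg (K + 1) hs.1.le
      have h4 := borelSum_le_one (K + 1) hs.1.le
      rw [Real.norm_eq_abs, abs_le]
      constructor <;> linarith
    · rw [Set.uIoc_of_le hb] at hs
      exact (tendsto_borelSum (by linarith [hs.1])).sub
        ((tendsto_borelSum hs.1.le).comp (tendsto_add_atTop_nat 1))
  have hlim' := (((tendsto_borelSum hb).comp (tendsto_add_atTop_nat 1)).sub_const 1)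
  have heq := tendsto_nhds_unique hlim' (hlim.congr fun K => (hK K).symm)
  have hI := fun {x y : ℝ} => @intervalIntegrable_tsum_borelTerm x y
  rw [heq, integral_sub _ (hI le_rfl hb), integral_comp_add_right (fun s => ∑' k, borelTerm k s),
    zero_add]
  · have h1 := integral_add_adjacent_intervals (hI (le_refl (0 : ℝ)) zero_le_one)
      (hI zero_le_one (by linarith : 0 ≤ b + 1))
    have h2 := integral_add_adjacent_intervals (hI (le_refl (0 : ℝ)) hb)
      (hI hb (by linarith : 0 ≤ b + 1))
    linarith
  · have := (hI (zero_le_one (α := ℝ)) (by linarith : 0 ≤ b + 1)).comp_add_right 1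
    simpa using this

/-- Abel's series at the critical parameter: the Borel–Tanner distribution has total mass `1`. -/
lemma tsum_borelTerm_eq_one {a : ℝ} (ha : 0 ≤ a) : ∑' k, borelTerm k a = 1 := by
  set E : ℝ → ℝ := fun x => 1 - ∑' k, borelTerm k x with hE
  have hE0 : ∀ x, 0 ≤ x → 0 ≤ E x := fun x hx => sub_nonneg.2 (tsum_borelTerm_le_one hx)
  have hEc : ContinuousOn E (Set.Ici 0) := continuousOn_const.sub continuousOn_tsum_borelTerm
  have hEint : ∀ x, 0 ≤ x → IntervalIntegrable E volume x (x + 1) := fun x hx =>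
    intervalIntegrable_const.sub (intervalIntegrable_tsum_borelTerm hx (by linarith))
  have hint : ∀ x, 0 ≤ x → ∫ s in x..(x + 1), E s = 1 - ∫ s in x..(x + 1), ∑' k, borelTerm k s :=
    fun x hx => by
      rw [hE, integral_sub intervalIntegrable_const
        (intervalIntegrable_tsum_borelTerm hx (by linarith))]
      simp
  set c := ∫ s in (0 : ℝ)..1, E s with hc
  have hEeq : ∀ x, 0 ≤ x → E x + c = ∫ s in x..(x + 1), E s := fun x hx => by
    have h0 := hint 0 le_rfl
    rw [zero_add] at h0
    have := tsum_borelTerm_sub_one hx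
    rw [hint x hx, hc, h0]
    simp only [hE]
    linarith
  have hcle : ∀ n : ℕ, ∀ x, 0 ≤ x → E x ≤ 1 - n * c := by
    intro n
    induction n with
    | zero =>
      intro x hx
      simpa [hE] using tsum_nonneg fun k => borelTerm_nonneg k hx
    | succ n ih =>
      intro x hx
      have h := integral_mono_on (by linarith : x ≤ x + 1) (hEint x hx)
        (intervalIntegrable_const (c := 1 - n * c)) fun s hs => ih s (hx.trans hs.1)
      rw [← hEeq x hx, intervalIntegral.integral_const] at h
      simp only [add_sub_cancel_left, one_smul] at h
      push_cast
      linarith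
  have hc0 : c ≤ 0 := by
    by_contra! hpos
    obtain ⟨n, hn⟩ := exists_nat_gt (1 / c)
    rw [div_lt_iff₀ hpos] at hn
    linarith [hcle n 0 le_rfl, hE0 0 le_rfl]
  have hc0' : c = 0 :=
    le_antisymm hc0 (integral_nonneg zero_le_one fun s hs => hE0 s hs.1)
  have hstep : ∀ x, 0 ≤ x → E x = 0 → ∀ y ∈ Set.Icc x (x + 1), E y = 0 := by
    intro x hx hx0 y hy
    have h := hEeq x hx
    rw [hx0, hc0', add_zero] at h
    by_contra hne
    have hpos := integral_pos (by linarith : x < x + 1)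
      (hEc.mono fun z hz => hx.trans hz.1) (fun z hz => hE0 z (hx.trans hz.1.le))
      ⟨y, hy, lt_of_le_of_ne (hE0 y (hx.trans hy.1)) (Ne.symm hne)⟩
    linarith
  have hnat : ∀ n : ℕ, E n = 0 := by
    intro n
    induction n with
    | zero =>
      have h := hEeq 0 le_rfl
      rw [zero_add, ← hc] at h
      simpa using h
    | succ n ih =>
      push_cast
      exact hstep n n.cast_nonneg ih _ ⟨by linarith, le_rfl⟩
  have h := hstep ⌊a⌋₊ (Nat.cast_nonneg _) (hnat _) a
    ⟨Nat.floor_le ha, (Nat.lt_floor_add_one a).le⟩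
  simp only [hE] at h
  linarith

lemma two_mul_massR {ρ σ : ℝ} (h : 0 < σ + ρ) (k : ℕ) :
    2 * massR ρ σ k = borelTerm k (σ + ρ) := by
  cases k with
  | zero => simp [massR, borelTerm]; field_simp
  | succ k =>
    have : σ + ρ + ((k : ℝ) + 1) ≠ 0 := by positivity
    simp only [massR, borelTerm]
    push_cast
    field_simp
    ring

lemma massR_nonneg {ρ σ : ℝ} (h : 0 < σ + ρ) (k : ℕ) : 0 ≤ massR ρ σ k := by
  have := two_mul_massR h k
  linarith [borelTerm_nonneg k h.le]

/-- Integral of `φ` against the discrete measure with atoms `±s_k(σ)` and masses `r_k(σ)`. -/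
noncomputable def spectralSum (ρ σ : ℝ) (φ : ℝ → ℝ) : ℝ :=
  ∑' k, massR ρ σ k * (φ (atomS ρ σ k) + φ (-atomS ρ σ k))

lemma summable_massR {ρ σ : ℝ} (h : 0 < σ + ρ) : Summable (massR ρ σ) := by
  refine ((summable_borelTerm h.le).mul_left (1 / 2)).congr fun k => ?_
  rw [← two_mul_massR h]
  ring

lemma atomS_nonneg (ρ σ : ℝ) (k : ℕ) : 0 ≤ atomS ρ σ k := Real.sqrt_nonneg _

lemma atomS_sq {ρ σ : ℝ} (hρ : 0 < ρ) (hσ : 0 < σ) (k : ℕ) :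
    atomS ρ σ k ^ 2 = ρ / (σ + ρ + k) :=
  Real.sq_sqrt (by positivity)

lemma atomS_le_one {ρ σ : ℝ} (hρ : 0 < ρ) (hσ : 0 < σ) (k : ℕ) : atomS ρ σ k ≤ 1 := by
  rw [atomS, Real.sqrt_le_one, div_le_one (by positivity)]
  linarith [(Nat.cast_nonneg k : (0 : ℝ) ≤ k)]

lemma summable_spectralSum {ρ σ : ℝ} (hρ : 0 < ρ) (hσ : 0 < σ) {φ : ℝ → ℝ} (hφ : Continuous φ) :
    Summable fun k => massR ρ σ k * (φ (atomS ρ σ k) + φ (-atomS ρ σ k)) := by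
  obtain ⟨C, hC⟩ := isCompact_Icc.exists_bound_of_continuousOn
    (hφ.continuousOn (s := Set.Icc (-1) 1))
  refine Summable.of_norm_bounded ((summable_massR (add_pos hσ hρ)).mul_right (C + C)) fun k => ?_
  have h0 := atomS_nonneg ρ σ k
  have h1 := atomS_le_one hρ hσ k
  rw [norm_mul, Real.norm_of_nonneg (massR_nonneg (add_pos hσ hρ) k)]
  exact mul_le_mul_of_nonneg_left
    (norm_add_le_of_le (hC _ ⟨by linarith, h1⟩) (hC _ ⟨by linarith, by linarith⟩))
    (massR_nonneg (add_pos hσ hρ) k)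

lemma spectralSum_sub {ρ σ : ℝ} (hρ : 0 < ρ) (hσ : 0 < σ) {φ ψ : ℝ → ℝ}
    (hφ : Continuous φ) (hψ : Continuous ψ) :
    spectralSum ρ σ (fun x => φ x - ψ x) = spectralSum ρ σ φ - spectralSum ρ σ ψ := by
  rw [spectralSum, spectralSum, spectralSum,
    ← (summable_spectralSum hρ hσ hφ).tsum_sub (summable_spectralSum hρ hσ hψ)]
  exact tsum_congr fun k => by ring

lemma spectralSum_const_mul (ρ σ c : ℝ) (φ : ℝ → ℝ) :
    spectralSum ρ σ (fun x => c * φ x) = c * spectralSum ρ σ φ := by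
  rw [spectralSum, spectralSum, ← tsum_mul_left]
  exact tsum_congr fun k => by ring

lemma spectralSum_one {ρ σ : ℝ} (hρ : 0 < ρ) (hσ : 0 < σ) : spectralSum ρ σ (fun _ => 1) = 1 := by
  refine Eq.trans ?_ (tsum_borelTerm_eq_one (add_pos hσ hρ).le)
  exact tsum_congr fun k => by rw [← two_mul_massR (add_pos hσ hρ)]; ring

lemma spectralSum_id (ρ σ : ℝ) : spectralSum ρ σ (fun x => x) = 0 := by
  simp [spectralSum]

lemma atomS_succ (ρ σ : ℝ) (k : ℕ) : atomS ρ σ (k + 1) = atomS ρ (σ + 1) k := by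
  rw [atomS, atomS]
  push_cast
  congr 2
  ring

lemma massR_succ {ρ σ : ℝ} (hρ : 0 < ρ) (hσ : 0 < σ) (k : ℕ) :
    massR ρ σ (k + 1) * (1 - (σ + ρ) / (σ + ρ + (k + 1 : ℕ))) =
      (σ + ρ) / (σ + 1 + ρ) * massR ρ (σ + 1) k := by
  have e : σ + 1 + ρ + (k : ℝ) = σ + ρ + (k + 1 : ℕ) := by push_cast; ring
  have h : σ + ρ + (k + 1 : ℕ) ≠ 0 := by positivity
  have h' : σ + 1 + ρ ≠ 0 := by positivity
  have hk : (k : ℝ) + 1 ≠ 0 := by positivity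
  simp only [massR, e, Nat.factorial_succ]
  rw [one_sub_div h]
  push_cast at *
  field_simp
  ring

lemma spectralSum_shift {ρ σ : ℝ} (hρ : 0 < ρ) (hσ : 0 < σ) {φ : ℝ → ℝ} (hφ : Continuous φ) :
    spectralSum ρ σ (fun x => (1 - (σ + ρ) * x ^ 2 / ρ) * φ x) =
      (σ + ρ) / (σ + 1 + ρ) * spectralSum ρ (σ + 1) φ := by
  have hcont : Continuous fun x : ℝ => (1 - (σ + ρ) * x ^ 2 / ρ) * φ x := by fun_prop
  have hsq : ∀ k : ℕ, (σ + ρ) * atomS ρ σ k ^ 2 / ρ = (σ + ρ) / (σ + ρ + k) := fun k => by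
    rw [atomS_sq hρ hσ]
    field_simp
  rw [spectralSum, (summable_spectralSum hρ hσ hcont).tsum_eq_zero_add, spectralSum,
    ← tsum_mul_left]
  simp only [neg_sq, hsq]
  rw [Nat.cast_zero, add_zero, div_self (add_pos hσ hρ).ne']
  simp only [sub_self, zero_mul, add_zero, mul_zero, zero_add]
  refine tsum_congr fun k => ?_
  rw [← mul_add, ← mul_assoc, massR_succ hρ hσ, atomS_succ, mul_assoc]

lemma continuous_Ppoly (ρ σ : ℝ) (n : ℕ) : Continuous fun x => Ppoly ρ σ x n := by
  induction n using Nat.twoStepInduction with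
  | zero => simpa [Ppoly] using continuous_const
  | one => simp only [Ppoly]; fun_prop
  | more n h0 h1 => simp only [Ppoly]; fun_prop

lemma Ppoly_recurrence {ρ : ℝ} (hρ : ρ ≠ 0) (σ x : ℝ) (n : ℕ) :
    ρ * Ppoly ρ σ x (n + 1) = (n + σ + ρ) * (x * Ppoly ρ σ x n) - n * Ppoly ρ σ x (n - 1) := by
  cases n with
  | zero => simp [Ppoly]; field_simp
  | succ n => simp only [Ppoly, Nat.add_sub_cancel]; push_cast; field_simp

lemma Ppoly_succ_eq_shift {ρ : ℝ} (hρ : ρ ≠ 0) (σ x : ℝ) (n : ℕ) :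
    ρ * Ppoly ρ σ x (n + 1) = ρ * Ppoly ρ (σ + 1) x (n + 1) - (n + 1) * x * Ppoly ρ (σ + 1) x n := by
  induction n using Nat.twoStepInduction with
  | zero => simp [Ppoly]; field_simp; ring
  | one => simp [Ppoly]; field_simp; ring
  | more n h0 h1 =>
    have r1 := Ppoly_recurrence hρ σ x (n + 2)
    have r2 := Ppoly_recurrence hρ (σ + 1) x (n + 2)
    have r3 := Ppoly_recurrence hρ (σ + 1) x (n + 1)
    simp only [Nat.add_succ_sub_one, Nat.add_sub_cancel] at r1 r2 r3
    push_cast at *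
    apply mul_left_cancel₀ hρ
    linear_combination ρ * r1 - ρ * r2 + (n + 2 + σ + ρ) * x * h1 - (n + 2) * h0 + (n + 2) * x * r3

lemma mul_Ppoly_succ {ρ : ℝ} (hρ : ρ ≠ 0) (σ x : ℝ) (n : ℕ) :
    x * Ppoly ρ σ x (n + 1) =
      Ppoly ρ σ x n - (1 - (σ + ρ) * x ^ 2 / ρ) * Ppoly ρ (σ + 1) x n := by
  cases n with
  | zero => simp [Ppoly]; field_simp
  | succ n =>
    have r2 := Ppoly_recurrence hρ (σ + 1) x (n + 1)
    have h1 := Ppoly_succ_eq_shift hρ σ x (n + 1)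
    have h0 := Ppoly_succ_eq_shift hρ σ x n
    simp only [Nat.add_sub_cancel] at r2
    push_cast at *
    apply mul_left_cancel₀ hρ
    field_simp
    linear_combination x * h1 + x * r2 - h0

lemma spectralSum_Ppoly_succ {ρ σ : ℝ} (hρ : 0 < ρ) (hσ : 0 < σ) (n : ℕ) :
    spectralSum ρ σ (fun x => Ppoly ρ σ x (n + 1)) = 0 := by
  have key : ∀ n : ℕ, ∀ σ : ℝ, 0 < σ → ρ * spectralSum ρ σ (fun x => Ppoly ρ σ x (n + 2)) =
      (n + 1 + σ + ρ) * (spectralSum ρ σ (fun x => Ppoly ρ σ x n) -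
        (σ + ρ) / (σ + 1 + ρ) * spectralSum ρ (σ + 1) (fun x => Ppoly ρ (σ + 1) x n)) -
      (n + 1) * spectralSum ρ σ (fun x => Ppoly ρ σ x n) := fun n σ hσ => by
    have c0 := continuous_Ppoly ρ σ n
    have c1 := continuous_Ppoly ρ σ (n + 1)
    have c2 := continuous_Ppoly ρ (σ + 1) n
    rw [← spectralSum_shift hρ hσ c2, ← spectralSum_sub hρ hσ c0 (by fun_prop),
      ← spectralSum_const_mul, ← spectralSum_const_mul, ← spectralSum_const_mul,
      ← spectralSum_sub hρ hσ (by fun_prop) (by fun_prop)]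
    congr 1
    ext x
    rw [← mul_Ppoly_succ hρ.ne', Ppoly_recurrence hρ.ne']
    push_cast
    simp
  induction n using Nat.twoStepInduction generalizing σ with
  | zero =>
    have : (fun x => Ppoly ρ σ x (0 + 1)) = fun x => (σ + ρ) / ρ * x := by
      ext x; simp only [Ppoly]; ring
    rw [this, spectralSum_const_mul, spectralSum_id, mul_zero]
  | one =>
    have h := key 0 σ hσ
    have h' : σ + 1 + ρ ≠ 0 := by positivity
    simp only [Ppoly.eq_1, spectralSum_one hρ hσ, spectralSum_one hρ (by linarith : 0 < σ + 1)] at h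
    have : (((0 : ℕ) : ℝ) + 1 + σ + ρ) * (1 - (σ + ρ) / (σ + 1 + ρ) * 1) - ((0 : ℕ) + 1) * 1 = 0 := by
      push_cast; field_simp; ring
    rw [this] at h
    exact (mul_eq_zero.1 h).resolve_left hρ.ne'
  | more n h0 _ =>
    have h := key (n + 1) σ hσ
    rw [h0 hσ, h0 (by linarith : 0 < σ + 1)] at h
    simp only [mul_zero, sub_zero] at h
    exact (mul_eq_zero.1 h).resolve_left hρ.ne'

lemma weightPi_succ {ρ σ : ℝ} (hρ : 0 < ρ) (hσ : 0 < σ) (n : ℕ) :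
    (σ + ρ + n) * (n + 1) * weightPi ρ σ (n + 1) = (σ + ρ + (n + 1)) * ρ * weightPi ρ σ n := by
  have : (n.factorial : ℝ) ≠ 0 := by positivity
  simp only [weightPi, Nat.factorial_succ]
  push_cast
  field_simp
  ring

lemma weightPi_pos {ρ σ : ℝ} (hρ : 0 < ρ) (hσ : 0 < σ) (n : ℕ) : 0 < weightPi ρ σ n := by
  rw [weightPi]
  positivity

lemma spectralSum_mul_Ppoly_succ {ρ σ : ℝ} (hρ : 0 < ρ) (hσ : 0 < σ) (n m : ℕ) :
    ρ * (n + σ + ρ) * spectralSum ρ σ (fun x => Ppoly ρ σ x n * Ppoly ρ σ x (m + 1)) =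
      (m + σ + ρ) * (ρ * spectralSum ρ σ (fun x => Ppoly ρ σ x (n + 1) * Ppoly ρ σ x m) +
        n * spectralSum ρ σ (fun x => Ppoly ρ σ x (n - 1) * Ppoly ρ σ x m)) -
      (n + σ + ρ) * m * spectralSum ρ σ (fun x => Ppoly ρ σ x n * Ppoly ρ σ x (m - 1)) := by
  have c := continuous_Ppoly ρ σ
  have cm : ∀ i j, Continuous fun x => Ppoly ρ σ x i * Ppoly ρ σ x j := fun i j => (c i).mul (c j)
  have cx : ∀ i j, Continuous fun x => x * (Ppoly ρ σ x i * Ppoly ρ σ x j) :=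
    fun i j => continuous_id.mul (cm i j)
  have h1 : ρ * spectralSum ρ σ (fun x => Ppoly ρ σ x n * Ppoly ρ σ x (m + 1)) =
      (m + σ + ρ) * spectralSum ρ σ (fun x => x * (Ppoly ρ σ x n * Ppoly ρ σ x m)) -
        m * spectralSum ρ σ (fun x => Ppoly ρ σ x n * Ppoly ρ σ x (m - 1)) := by
    simp only [← spectralSum_const_mul]
    rw [← spectralSum_sub hρ hσ ((cx _ _).const_mul _) ((cm _ _).const_mul _)]
    congr 1
    ext x
    linear_combination Ppoly ρ σ x n * Ppoly_recurrence hρ.ne' σ x m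
  have h2 : ρ * spectralSum ρ σ (fun x => Ppoly ρ σ x (n + 1) * Ppoly ρ σ x m) =
      (n + σ + ρ) * spectralSum ρ σ (fun x => x * (Ppoly ρ σ x n * Ppoly ρ σ x m)) -
        n * spectralSum ρ σ (fun x => Ppoly ρ σ x (n - 1) * Ppoly ρ σ x m) := by
    simp only [← spectralSum_const_mul]
    rw [← spectralSum_sub hρ hσ ((cx _ _).const_mul _) ((cm _ _).const_mul _)]
    congr 1
    ext x
    linear_combination Ppoly ρ σ x m * Ppoly_recurrence hρ.ne' σ x n
  linear_combination (n + σ + ρ) * h1 - (m + σ + ρ) * h2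

lemma spectralSum_Ppoly_mul_Ppoly {ρ σ : ℝ} (hρ : 0 < ρ) (hσ : 0 < σ) (n m : ℕ) :
    spectralSum ρ σ (fun x => Ppoly ρ σ x n * Ppoly ρ σ x m) =
      if n = m then 1 / weightPi ρ σ n else 0 := by
  induction m using Nat.strong_induction_on generalizing n with
  | _ m ih =>
  cases m with
  | zero =>
    simp only [Ppoly.eq_1, mul_one]
    cases n with
    | zero =>
      have : σ + ρ ≠ 0 := by positivity
      simp [Ppoly.eq_1, spectralSum_one hρ hσ, weightPi, this]
    | succ n => simp [spectralSum_Ppoly_succ hρ hσ]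
  | succ m =>
    have h := spectralSum_mul_Ppoly_succ hρ hσ n m
    have hne : ρ * (n + σ + ρ) ≠ 0 := by positivity
    apply mul_left_cancel₀ hne
    rw [h, ih m (by omega), ih m (by omega), ih (m - 1) (by omega)]
    rcases eq_or_ne n (m + 1) with rfl | h1
    · have w := weightPi_succ hρ hσ m
      have p0 := weightPi_pos hρ hσ m
      have p1 := weightPi_pos hρ hσ (m + 1)
      rw [if_neg (by omega), if_pos (by omega), if_neg (by omega), if_pos rfl, Nat.add_sub_cancel]
      push_cast
      field_simp
      linear_combination w
    rw [if_neg h1]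
    rcases eq_or_ne (n + 1) m with rfl | h2
    · have w := weightPi_succ hρ hσ n
      have p0 := weightPi_pos hρ hσ n
      have p1 := weightPi_pos hρ hσ (n + 1)
      rw [if_pos rfl, if_neg (by omega), Nat.add_sub_cancel, if_pos rfl]
      push_cast
      field_simp
      linear_combination -w
    rw [if_neg h2]
    rcases Nat.eq_zero_or_pos n with rfl | hn
    · rcases Nat.eq_zero_or_pos m with rfl | hm
      · simp
      · rw [if_neg (by omega : ¬ 0 = m - 1)]; simp
    · rw [if_neg (by omega : ¬ n - 1 = m)]
      rcases Nat.eq_zero_or_pos m with rfl | hm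
      · simp
      · rw [if_neg (by omega)]; simp

/-- orthogonality relations of the polynomials `P_n(σ;·)` with respect to the
discrete spectral measure with atoms at `±s_k(σ)` and masses `r_k(σ)`. -/
theorem Ppoly_orthogonality (ρ σ : ℝ) (hρ : 0 < ρ) (hσ : 0 < σ) (n m : ℕ) :
    HasSum
      (fun k : ℕ => massR ρ σ k *
        (Ppoly ρ σ (atomS ρ σ k) n * Ppoly ρ σ (atomS ρ σ k) m +
          Ppoly ρ σ (-atomS ρ σ k) n * Ppoly ρ σ (-atomS ρ σ k) m))
      (if n = m then 1 / weightPi ρ σ n else 0) := by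
  rw [← spectralSum_Ppoly_mul_Ppoly hρ hσ]
  exact (summable_spectralSum hρ hσ
    ((continuous_Ppoly ρ σ n).mul (continuous_Ppoly ρ σ m))).hasSum
end

section
/- Let ρ > 0, t ≥ 0 and m ∈ ℕ. Then (ρ^m/m!) · e^{−ρ} · Σ_{n=0}^∞ C_m(n;ρ) · e^{−nt} · ρ^n/n! = e^{−ρ(1−e^{−t})} · (ρ(1−e^{−t}))^m/m!. (This is the Karlin–McGregor formula: for an initially empty M/M/∞ queue with arrival rate ρ and unit service rate, the number of customers at time t is Poisson with mean ρ(1−e^{−t}).) -/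
/-- The backward shift and the difference relation of the Charlier polynomials. -/
theorem charlier_shift_and_difference {a : ℝ} (ha : a ≠ 0) (x : ℝ) (m : ℕ) :
    charlier a x (m + 1) = charlier a x m - x / a * charlier a (x - 1) m ∧
      charlier a x (m + 1) - charlier a (x - 1) (m + 1) =
        -(((m : ℝ) + 1) / a * charlier a (x - 1) m) := by
  induction m with
  | zero =>
    simp only [charlier]
    constructor
    · field_simp
    · field_simp
      push_cast
      ring
  | succ m ih =>
    obtain ⟨hshift, hdiff⟩ := ih
    have hrec (y : ℝ) : a * charlier a y (m + 2) =
        ((m : ℝ) + 1 + a - y) * charlier a y (m + 1) - ((m : ℝ) + 1) * charlier a y m := by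
      rw [charlier]
      field_simp
    have hx := hrec x
    have hx' := hrec (x - 1)
    field_simp at hshift hdiff
    have hshift' : a * charlier a x (m + 2) =
        a * charlier a x (m + 1) - x * charlier a (x - 1) (m + 1) := by
      refine mul_left_cancel₀ ha ?_
      linear_combination a * hx + ((m : ℝ) + 1) * hshift - x * hdiff
    constructor
    · field_simp
      linear_combination hshift'
    · field_simp
      push_cast
      linear_combination hshift' - hx' + hdiff

/-- The exponential generating function of `n ↦ C_m(n;a)`. -/
theorem hasSum_charlier_mul_pow_div_factorial {a : ℝ} (ha : a ≠ 0) (z : ℝ) (m : ℕ) :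
    HasSum (fun n : ℕ => charlier a n m * (z ^ n / n.factorial))
      (Real.exp z * (1 - z / a) ^ m) := by
  induction m with
  | zero =>
    simpa [charlier, Real.exp_eq_exp_ℝ] using NormedSpace.expSeries_div_hasSum_exp z
  | succ m ih =>
    have hshifted : HasSum
        (fun n : ℕ => (n : ℝ) / a * charlier a ((n : ℝ) - 1) m * (z ^ n / n.factorial))
        (z / a * (Real.exp z * (1 - z / a) ^ m)) := by
      rw [← hasSum_nat_add_iff' 1]
      simp only [Finset.range_one, Finset.sum_singleton, Nat.cast_zero, zero_div, zero_mul,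
        sub_zero]
      refine (ih.mul_left (z / a)).congr_fun fun n => ?_
      rw [Nat.factorial_succ]
      push_cast
      rw [add_sub_cancel_right]
      field_simp
      ring
    rw [show Real.exp z * (1 - z / a) ^ (m + 1) =
      Real.exp z * (1 - z / a) ^ m - z / a * (Real.exp z * (1 - z / a) ^ m) by ring]
    refine (ih.sub hshifted).congr_fun fun n => ?_
    rw [(charlier_shift_and_difference ha n m).1]
    ring

/-- Karlin–McGregor: for an initially empty `M/M/∞` queue with arrival rate `ρ`
and unit service rate, the number of customers at time `t` is Poisson with mean `ρ(1−e^{−t})`: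
`(ρ^m/m!) e^{−ρ} Σ_n C_m(n;ρ) e^{−nt} ρ^n/n! = e^{−ρ(1−e^{−t})} (ρ(1−e^{−t}))^m/m!`. -/
theorem karlin_mcgregor_mminf (ρ t : ℝ) (hρ : 0 < ρ) (ht : 0 ≤ t) (m : ℕ) :
    HasSum
      (fun n : ℕ => ρ ^ m / m.factorial * Real.exp (-ρ) *
        (charlier ρ (n : ℝ) m * Real.exp (-(n : ℝ) * t) * ρ ^ n / n.factorial))
      (Real.exp (-(ρ * (1 - Real.exp (-t)))) * (ρ * (1 - Real.exp (-t))) ^ m / m.factorial) := by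
  have hvalue : Real.exp (-(ρ * (1 - Real.exp (-t)))) * (ρ * (1 - Real.exp (-t))) ^ m /
      m.factorial = ρ ^ m / m.factorial * Real.exp (-ρ) *
        (Real.exp (ρ * Real.exp (-t)) * (1 - ρ * Real.exp (-t) / ρ) ^ m) := by
    rw [mul_div_cancel_left₀ _ hρ.ne', mul_pow,
      show -(ρ * (1 - Real.exp (-t))) = -ρ + ρ * Real.exp (-t) by ring, Real.exp_add]
    ring
  rw [hvalue]
  refine ((hasSum_charlier_mul_pow_div_factorial hρ.ne' (ρ * Real.exp (-t)) m).mul_left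
    _).congr_fun fun n => ?_
  rw [mul_pow, ← Real.exp_nat_mul, neg_mul, mul_neg]
  ring
end

section
/- Let ρ > 0 and σ > 0. For every m ∈ ℕ, the series Σ_{k=0}^∞ p_k(m) converges and (σ/(m+σ+ρ)) · Σ_{k=0}^∞ p_k(m) = σ · (ρ^m/m!) · e^{−ρ} · Σ_{n=0}^∞ (C_m(n;ρ)/(σ+n)) · ρ^n/n!. (The left-hand side is the probability that the number ν(σ) of customers in the initially empty M/M/∞ queue equals m when an observer present during an exp(σ)-distributed time leaves the system.) -/
/-- `p_k(m)`: probability that the absorbed discrete-time chain of the `M/M/∞` queue observed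
during an `exp(σ)` time, started empty, is in state `m` after `k` transitions without having
been absorbed. -/
noncomputable def pchain (ρ σ : ℝ) : ℕ → ℕ → ℝ
  | 0, m => if m = 0 then 1 else 0
  | k + 1, m =>
      (if 1 ≤ m then pchain ρ σ k (m - 1) * ρ / (((m : ℝ) - 1) + σ + ρ) else 0) +
        pchain ρ σ k (m + 1) * ((m : ℝ) + 1) / (((m : ℝ) + 1) + σ + ρ)

/-- The sequence `m! / (x (x + 1) ⋯ (x + m))`, equal to the Beta value `B(x, m + 1)`. -/
noncomputable def betaNat (m : ℕ) (x : ℝ) : ℝ :=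
  m.factorial / ∏ j ∈ Finset.range (m + 1), (x + j)

lemma betaNat_nonneg (m : ℕ) {x : ℝ} (hx : 0 < x) : 0 ≤ betaNat m x := by
  unfold betaNat
  positivity

lemma betaNat_succ (m : ℕ) {x : ℝ} (hx : 0 < x) :
    betaNat (m + 1) x = betaNat m x - betaNat m (x + 1) := by
  have h_shift : ∏ j ∈ Finset.range (m + 1), (x + 1 + (j : ℝ)) =
      (∏ j ∈ Finset.range (m + 1), (x + (j : ℝ))) * (x + (m + 1 : ℕ)) / x := by
    rw [← Finset.prod_range_succ (fun j : ℕ => x + (j : ℝ)),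
      Finset.prod_range_succ' _ (m + 1), Nat.cast_zero, add_zero, mul_div_cancel_right₀ _ hx.ne']
    refine Finset.prod_congr rfl fun j _ => ?_
    push_cast
    ring
  have h_pos : 0 < ∏ j ∈ Finset.range (m + 1), (x + (j : ℝ)) := by positivity
  unfold betaNat
  rw [h_shift, Finset.prod_range_succ _ (m + 1), Nat.factorial_succ]
  push_cast
  have h_ne : x + ((m : ℝ) + 1) ≠ 0 := by positivity
  field_simp
  ring

/-- The forward ladder relation of the Charlier polynomials. -/
lemma charlier_succ {a : ℝ} (ha : a ≠ 0) (x : ℝ) (m : ℕ) :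
    a * charlier a x (m + 1) = a * charlier a x m - x * charlier a (x - 1) m := by
  have h_rec : ∀ (y : ℝ) (n : ℕ), a * charlier a y (n + 2) =
      ((n : ℝ) + 1 + a - y) * charlier a y (n + 1) - ((n : ℝ) + 1) * charlier a y n := by
    intro y n
    rw [charlier]
    field_simp
  have h_one : ∀ y : ℝ, a * charlier a y 1 = a - y := by
    intro y
    rw [charlier]
    field_simp
  induction m using Nat.twoStepInduction with
  | zero => rw [zero_add, h_one]; simp [charlier]
  | one =>
    have h0 := h_rec x 0
    have h1 := h_one x
    have h2 := h_one (x - 1)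
    simp only [charlier.eq_1, Nat.cast_zero, zero_add, mul_one] at h0
    apply mul_left_cancel₀ ha
    linear_combination a * h0 + (1 - x) * h1 + x * h2
  | more n h0 h1 =>
    have h2 := h_rec x (n + 1)
    have h3 := h_rec x n
    have h4 := h_rec (x - 1) n
    push_cast at h2
    apply mul_left_cancel₀ ha
    linear_combination a * h2 + ((n : ℝ) + 2 + a - x) * h1 - ((n : ℝ) + 1) * h0 - a * h3 + x * h4

/-- The Charlier polynomial at `n`, weighted by `ρ ^ n / n!`. -/
noncomputable def charlierTerm (ρ : ℝ) (m n : ℕ) : ℝ :=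
  charlier ρ n m * (ρ ^ n / n.factorial)

lemma charlierTerm_succ_zero {ρ : ℝ} (hρ : 0 < ρ) (m : ℕ) :
    charlierTerm ρ (m + 1) 0 = charlierTerm ρ m 0 := by
  have h := charlier_succ hρ.ne' 0 m
  rw [zero_mul, sub_zero] at h
  simp [charlierTerm, mul_left_cancel₀ hρ.ne' h]

lemma charlierTerm_succ_succ {ρ : ℝ} (hρ : 0 < ρ) (m n : ℕ) :
    charlierTerm ρ (m + 1) (n + 1) = charlierTerm ρ m (n + 1) - charlierTerm ρ m n := by
  have h := charlier_succ hρ.ne' ((n + 1 : ℕ) : ℝ) m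
  have h_cast : ((n + 1 : ℕ) : ℝ) - 1 = n := by push_cast; ring
  rw [h_cast] at h
  unfold charlierTerm
  rw [Nat.factorial_succ, pow_succ]
  push_cast at h ⊢
  field_simp
  linear_combination h

lemma charlierTerm_zero (ρ : ℝ) (n : ℕ) : charlierTerm ρ 0 n = ρ ^ n / n.factorial := by
  simp [charlierTerm, charlier]

lemma summable_charlierTerm {ρ : ℝ} (hρ : 0 < ρ) (m : ℕ) : Summable (charlierTerm ρ m) := by
  induction m with
  | zero => exact (Real.summable_pow_div_factorial ρ).congr fun n => (charlierTerm_zero ρ n).symm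
  | succ m ih =>
    rw [← summable_nat_add_iff 1]
    exact (((summable_nat_add_iff 1).2 ih).sub ih).congr
      fun n => (charlierTerm_succ_succ hρ m n).symm

lemma tsum_charlierTerm_zero (ρ : ℝ) : ∑' n, charlierTerm ρ 0 n = Real.exp ρ := by
  simp only [charlierTerm_zero, Real.exp_eq_exp_ℝ, NormedSpace.exp_eq_tsum_div]

lemma tsum_charlierTerm_succ {ρ : ℝ} (hρ : 0 < ρ) (m : ℕ) :
    ∑' n, charlierTerm ρ (m + 1) n = 0 := by
  have h := summable_charlierTerm hρ m
  rw [(summable_charlierTerm hρ (m + 1)).tsum_eq_zero_add, charlierTerm_succ_zero hρ]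
  simp only [charlierTerm_succ_succ hρ]
  rw [((summable_nat_add_iff 1).2 h).tsum_sub h, h.tsum_eq_zero_add]
  ring

lemma summable_charlierTerm_div {ρ s : ℝ} (hρ : 0 < ρ) (hs : 0 < s) (m : ℕ) :
    Summable fun n : ℕ => charlierTerm ρ m n / (s + n) := by
  refine Summable.of_norm_bounded ((summable_charlierTerm hρ m).norm.div_const s) fun n => ?_
  rw [norm_div]
  gcongr
  rw [Real.norm_of_nonneg (by positivity)]
  linarith [n.cast_nonneg (α := ℝ)]

/-- The series `∑ C_m(n;ρ) / (s + n) · ρ ^ n / n!`. -/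
noncomputable def charlierSum (ρ s : ℝ) (m : ℕ) : ℝ :=
  ∑' n : ℕ, charlierTerm ρ m n / (s + n)

lemma charlierSum_succ {ρ s : ℝ} (hρ : 0 < ρ) (hs : 0 < s) (m : ℕ) :
    charlierSum ρ s (m + 1) = charlierSum ρ s m - charlierSum ρ (s + 1) m := by
  have h := summable_charlierTerm_div hρ hs m
  have h_shift := summable_charlierTerm_div hρ (add_pos hs one_pos) m
  have h_term : ∀ n : ℕ, charlierTerm ρ (m + 1) (n + 1) / (s + (n + 1 : ℕ)) =
      charlierTerm ρ m (n + 1) / (s + (n + 1 : ℕ)) - charlierTerm ρ m n / (s + 1 + n) := by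
    intro n
    rw [charlierTerm_succ_succ hρ, sub_div]
    push_cast
    ring
  unfold charlierSum
  rw [(summable_charlierTerm_div hρ hs (m + 1)).tsum_eq_zero_add, charlierTerm_succ_zero hρ]
  simp only [h_term]
  rw [((summable_nat_add_iff 1).2 h).tsum_sub h_shift, h.tsum_eq_zero_add]
  ring

lemma hasSum_betaNat_charlierSum {ρ : ℝ} (hρ : 0 < ρ) (m : ℕ) {s : ℝ} (hs : 0 < s) :
    HasSum (fun n : ℕ => ρ ^ n / n.factorial * betaNat m (s + n)) (charlierSum ρ s m) := by
  induction m generalizing s with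
  | zero =>
    refine (summable_charlierTerm_div hρ hs 0).hasSum.congr_fun fun n => ?_
    simp [charlierTerm_zero, betaNat, div_eq_mul_inv]
  | succ m ih =>
    rw [charlierSum_succ hρ hs]
    refine ((ih hs).sub (ih (add_pos hs one_pos))).congr_fun fun n => ?_
    rw [betaNat_succ m (by positivity), add_right_comm s 1, mul_sub]

lemma charlierSum_nonneg {ρ s : ℝ} (hρ : 0 < ρ) (hs : 0 < s) (m : ℕ) :
    0 ≤ charlierSum ρ s m :=
  (hasSum_betaNat_charlierSum hρ m hs).nonneg fun n =>
    mul_nonneg (by positivity) (betaNat_nonneg m (by positivity))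

lemma charlierSum_le {ρ s : ℝ} (hρ : 0 < ρ) (hs : 0 < s) (m : ℕ) :
    charlierSum ρ s m ≤ charlierSum ρ s 0 := by
  induction m with
  | zero => rfl
  | succ m ih =>
    rw [charlierSum_succ hρ hs]
    linarith [charlierSum_nonneg hρ (add_pos hs one_pos) m]

lemma charlierSum_one {ρ s : ℝ} (hρ : 0 < ρ) (hs : 0 < s) :
    ρ * charlierSum ρ s 1 = (s + ρ) * charlierSum ρ s 0 - Real.exp ρ := by
  rw [← tsum_charlierTerm_zero]
  unfold charlierSum
  rw [← tsum_mul_left, ← tsum_mul_left, ← ((summable_charlierTerm_div hρ hs 0).mul_left _).tsum_sub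
    (summable_charlierTerm hρ 0)]
  congr 1 with n
  have h_ne : s + (n : ℝ) ≠ 0 := by positivity
  simp only [charlierTerm, charlier]
  field_simp
  ring

lemma charlierSum_add_two {ρ s : ℝ} (hρ : 0 < ρ) (hs : 0 < s) (m : ℕ) :
    ρ * charlierSum ρ s (m + 2) =
      (m + 1 + s + ρ) * charlierSum ρ s (m + 1) - (m + 1) * charlierSum ρ s m := by
  have h_zero := tsum_charlierTerm_succ hρ m
  have h_summable := summable_charlierTerm hρ (m + 1)
  have h0 := (summable_charlierTerm_div hρ hs m).mul_left ((m : ℝ) + 1)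
  have h1 := (summable_charlierTerm_div hρ hs (m + 1)).mul_left ((m : ℝ) + 1 + s + ρ)
  rw [← sub_zero (_ - _ : ℝ), ← h_zero]
  unfold charlierSum
  rw [← tsum_mul_left, ← tsum_mul_left, ← tsum_mul_left, ← h1.tsum_sub h0,
    ← (h1.sub h0).tsum_sub h_summable]
  congr 1 with n
  have h_ne : s + (n : ℝ) ≠ 0 := by positivity
  simp only [charlierTerm, charlier]
  field_simp
  ring

lemma pchain_nonneg {ρ σ : ℝ} (hρ : 0 < ρ) (hσ : 0 < σ) (k m : ℕ) : 0 ≤ pchain ρ σ k m := by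
  induction k generalizing m with
  | zero => rw [pchain]; split_ifs <;> norm_num
  | succ k ih =>
    rw [pchain]
    have h_up := ih (m + 1)
    refine add_nonneg ?_ (by positivity)
    split_ifs with hm
    · have h_down := ih (m - 1)
      have hm' : (0 : ℝ) ≤ (m : ℝ) - 1 := sub_nonneg.2 (by exact_mod_cast hm)
      positivity
    · rfl

lemma pchain_eq_zero_of_lt (ρ σ : ℝ) {k m : ℕ} (h : k < m) : pchain ρ σ k m = 0 := by
  induction k generalizing m with
  | zero => rw [pchain, if_neg (by lia)]
  | succ k ih => rw [pchain, ih (by lia : k < m - 1), ih (by lia : k < m + 1)]; simp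

/-- The probability `p_k(m)` divided by the total rate `m + σ + ρ`. -/
noncomputable def pchainDiv (ρ σ : ℝ) (k m : ℕ) : ℝ := pchain ρ σ k m / (m + σ + ρ)

lemma pchainDiv_nonneg {ρ σ : ℝ} (hρ : 0 < ρ) (hσ : 0 < σ) (k m : ℕ) :
    0 ≤ pchainDiv ρ σ k m :=
  div_nonneg (pchain_nonneg hρ hσ k m) (by positivity)

lemma pchain_eq_mul_pchainDiv {ρ σ : ℝ} (hρ : 0 < ρ) (hσ : 0 < σ) (k m : ℕ) :
    pchain ρ σ k m = (m + σ + ρ) * pchainDiv ρ σ k m := by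
  have h_ne : (m : ℝ) + σ + ρ ≠ 0 := by positivity
  unfold pchainDiv
  field_simp

lemma pchain_succ_zero (ρ σ : ℝ) (k : ℕ) : pchain ρ σ (k + 1) 0 = pchainDiv ρ σ k 1 := by
  rw [pchain]
  simp [pchainDiv]

lemma pchain_succ_succ (ρ σ : ℝ) (k m : ℕ) :
    pchain ρ σ (k + 1) (m + 1) =
      ρ * pchainDiv ρ σ k m + (m + 2) * pchainDiv ρ σ k (m + 2) := by
  rw [pchain, if_pos (by lia)]
  simp only [pchainDiv, Nat.add_sub_cancel]
  push_cast
  ring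

lemma sum_pchain_succ (ρ σ : ℝ) (k N : ℕ) :
    ∑ m ∈ Finset.range (N + 1), pchain ρ σ (k + 1) m =
      ∑ m ∈ Finset.range (N + 1), (ρ + m) * pchainDiv ρ σ k m +
        (N + 1) * pchainDiv ρ σ k (N + 1) - ρ * pchainDiv ρ σ k N := by
  induction N with
  | zero => simp [pchain_succ_zero]
  | succ N ih =>
    rw [Finset.sum_range_succ, ih, Finset.sum_range_succ _ (N + 1), pchain_succ_succ]
    push_cast
    ring

/-- Conservation of mass: the mass absorbed in the first `K` transitions and the surviving mass
add up to one. -/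
lemma sum_pchainDiv_add_sum_pchain {ρ σ : ℝ} (hρ : 0 < ρ) (hσ : 0 < σ) {K N : ℕ} (h : K ≤ N) :
    σ * ∑ k ∈ Finset.range K, ∑ m ∈ Finset.range (N + 1), pchainDiv ρ σ k m +
      ∑ m ∈ Finset.range (N + 1), pchain ρ σ K m = 1 := by
  induction K with
  | zero => simp [pchain]
  | succ K ih =>
    have h_mass : ∑ m ∈ Finset.range (N + 1), pchain ρ σ K m =
        ∑ m ∈ Finset.range (N + 1), (ρ + m) * pchainDiv ρ σ K m +
          σ * ∑ m ∈ Finset.range (N + 1), pchainDiv ρ σ K m := by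
      rw [Finset.mul_sum, ← Finset.sum_add_distrib]
      refine Finset.sum_congr rfl fun m _ => ?_
      rw [pchain_eq_mul_pchainDiv hρ hσ]
      ring
    have h_top : pchainDiv ρ σ K (N + 1) = 0 := by
      rw [pchainDiv, pchain_eq_zero_of_lt ρ σ (by lia), zero_div]
    have h_next : pchainDiv ρ σ K N = 0 := by
      rw [pchainDiv, pchain_eq_zero_of_lt ρ σ (by lia), zero_div]
    rw [Finset.sum_range_succ, sum_pchain_succ, h_top, h_next]
    linarith [ih (by lia)]

lemma sum_sum_pchainDiv_le {ρ σ : ℝ} (hρ : 0 < ρ) (hσ : 0 < σ) (K N : ℕ) :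
    ∑ k ∈ Finset.range K, ∑ m ∈ Finset.range N, pchainDiv ρ σ k m ≤ 1 / σ := by
  have h_mono : ∑ k ∈ Finset.range K, ∑ m ∈ Finset.range N, pchainDiv ρ σ k m ≤
      ∑ k ∈ Finset.range K, ∑ m ∈ Finset.range (K + N + 1), pchainDiv ρ σ k m := by
    gcongr with k _
    · exact fun m _ _ => pchainDiv_nonneg hρ hσ k m
    · lia
  have h_mass := sum_pchainDiv_add_sum_pchain hρ hσ (Nat.le_add_right K N)
  have h_nonneg : 0 ≤ ∑ m ∈ Finset.range (K + N + 1), pchain ρ σ K m :=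
    Finset.sum_nonneg fun m _ => pchain_nonneg hρ hσ K m
  rw [le_div_iff₀ hσ]
  nlinarith

lemma summable_pchainDiv {ρ σ : ℝ} (hρ : 0 < ρ) (hσ : 0 < σ) (m : ℕ) :
    Summable fun k => pchainDiv ρ σ k m := by
  refine summable_of_sum_range_le (c := 1 / σ) (fun k => pchainDiv_nonneg hρ hσ k m) fun K => ?_
  refine le_trans (Finset.sum_le_sum fun k _ => ?_) (sum_sum_pchainDiv_le hρ hσ K (m + 1))
  exact Finset.single_le_sum (f := pchainDiv ρ σ k) (fun j _ => pchainDiv_nonneg hρ hσ k j)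
    (Finset.self_mem_range_succ m)

lemma summable_pchain {ρ σ : ℝ} (hρ : 0 < ρ) (hσ : 0 < σ) (m : ℕ) :
    Summable fun k => pchain ρ σ k m :=
  ((summable_pchainDiv hρ hσ m).mul_left ((m : ℝ) + σ + ρ)).congr
    fun k => (pchain_eq_mul_pchainDiv hρ hσ k m).symm

/-- The Green function of the chain started at `0`, divided by the total rate. -/
noncomputable def greenDiv (ρ σ : ℝ) (m : ℕ) : ℝ := ∑' k, pchainDiv ρ σ k m

lemma summable_greenDiv {ρ σ : ℝ} (hρ : 0 < ρ) (hσ : 0 < σ) : Summable (greenDiv ρ σ) := by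
  refine summable_of_sum_range_le (c := 1 / σ)
    (fun m => tsum_nonneg fun k => pchainDiv_nonneg hρ hσ k m) fun N => ?_
  unfold greenDiv
  rw [← Summable.tsum_finsetSum fun m _ => summable_pchainDiv hρ hσ m]
  exact Real.tsum_le_of_sum_range_le
    (fun k => Finset.sum_nonneg fun m _ => pchainDiv_nonneg hρ hσ k m)
    fun K => sum_sum_pchainDiv_le hρ hσ K N

lemma tsum_pchain {ρ σ : ℝ} (hρ : 0 < ρ) (hσ : 0 < σ) (m : ℕ) :
    ∑' k, pchain ρ σ k m = (m + σ + ρ) * greenDiv ρ σ m := by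
  simp only [pchain_eq_mul_pchainDiv hρ hσ, tsum_mul_left, greenDiv]

lemma greenDiv_one {ρ σ : ℝ} (hρ : 0 < ρ) (hσ : 0 < σ) :
    greenDiv ρ σ 1 = (σ + ρ) * greenDiv ρ σ 0 - 1 := by
  have h := (summable_pchain hρ hσ 0).tsum_eq_zero_add
  simp only [tsum_pchain hρ hσ, pchain_succ_zero] at h
  rw [← greenDiv] at h
  simp only [pchain, if_true, Nat.cast_zero, zero_add] at h
  linarith

lemma greenDiv_add_two {ρ σ : ℝ} (hρ : 0 < ρ) (hσ : 0 < σ) (m : ℕ) :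
    (m + 2) * greenDiv ρ σ (m + 2) =
      (m + 1 + σ + ρ) * greenDiv ρ σ (m + 1) - ρ * greenDiv ρ σ m := by
  have h := (summable_pchain hρ hσ (m + 1)).tsum_eq_zero_add
  simp only [pchain_succ_succ] at h
  rw [tsum_pchain hρ hσ, ((summable_pchainDiv hρ hσ m).mul_left ρ).tsum_add
    ((summable_pchainDiv hρ hσ (m + 2)).mul_left _), tsum_mul_left, tsum_mul_left,
    ← greenDiv, ← greenDiv] at h
  simp only [pchain, Nat.add_eq_zero_iff, one_ne_zero, and_false, if_false] at h
  push_cast at h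
  linarith

lemma balance_zero_nonpos {ρ σ : ℝ} (hρ : 0 < ρ) (hσ : 0 < σ) {D : ℕ → ℝ} (hD : Summable D)
    (h_one : D 1 = (σ + ρ) * D 0)
    (h_rec : ∀ m : ℕ, (m + 2) * D (m + 2) = (m + 1 + σ + ρ) * D (m + 1) - ρ * D m) :
    D 0 ≤ 0 := by
  by_contra! h_pos
  have h_flow : ∀ m : ℕ, 0 ≤ D m ∧ σ * D 0 ≤ (m + 1) * D (m + 1) - ρ * D m := by
    intro m
    induction m with
    | zero => exact ⟨h_pos.le, by norm_num; linarith⟩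
    | succ m ih =>
      have h_nonneg : 0 ≤ D (m + 1) := by
        have h_mul : 0 ≤ ((m : ℝ) + 1) * D (m + 1) := by nlinarith [mul_pos hσ h_pos]
        exact nonneg_of_mul_nonneg_right h_mul (by positivity)
      refine ⟨h_nonneg, ?_⟩
      push_cast
      nlinarith [h_rec m, mul_nonneg hσ.le h_nonneg]
  have h_bound : ∀ m : ℕ, 1 / ((m + 1 : ℕ) : ℝ) ≤ D (m + 1) / (σ * D 0) := by
    intro m
    have h_prod := mul_pos hσ h_pos
    rw [div_le_div_iff₀ (by positivity) h_prod]
    push_cast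
    nlinarith [h_flow m, mul_nonneg hρ.le (h_flow m).1]
  refine Real.not_summable_one_div_natCast ((summable_nat_add_iff 1).1 ?_)
  exact Summable.of_nonneg_of_le (fun m => by positivity) h_bound
    (((summable_nat_add_iff 1).2 hD).div_const _)

/-- The homogeneous balance equations have no nonzero summable solution. -/
lemma balance_eq_zero {ρ σ : ℝ} (hρ : 0 < ρ) (hσ : 0 < σ) {D : ℕ → ℝ} (hD : Summable D)
    (h_one : D 1 = (σ + ρ) * D 0)
    (h_rec : ∀ m : ℕ, (m + 2) * D (m + 2) = (m + 1 + σ + ρ) * D (m + 1) - ρ * D m) (m : ℕ) :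
    D m = 0 := by
  have h_neg : -D 0 ≤ 0 := balance_zero_nonpos (D := fun m => -D m) hρ hσ hD.neg
    (by linarith) fun m => by linarith [h_rec m]
  have h_zero : D 0 = 0 := le_antisymm (balance_zero_nonpos hρ hσ hD h_one h_rec) (by linarith)
  induction m using Nat.twoStepInduction with
  | zero => exact h_zero
  | one => rw [h_one, h_zero, mul_zero]
  | more n h0 h1 =>
    have h := h_rec n
    rw [h0, h1, mul_zero, mul_zero, sub_zero] at h
    exact (mul_eq_zero.1 h).resolve_left (by positivity)

lemma greenDiv_eq {ρ σ : ℝ} (hρ : 0 < ρ) (hσ : 0 < σ) (m : ℕ) :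
    greenDiv ρ σ m = ρ ^ m / m.factorial * Real.exp (-ρ) * charlierSum ρ σ m := by
  have h_summable : Summable fun m : ℕ =>
      ρ ^ m / m.factorial * Real.exp (-ρ) * charlierSum ρ σ m := by
    refine Summable.of_nonneg_of_le (fun m => ?_) (fun m => ?_)
      (((Real.summable_pow_div_factorial ρ).mul_right (Real.exp (-ρ))).mul_right
        (charlierSum ρ σ 0))
    · exact mul_nonneg (by positivity) (charlierSum_nonneg hρ hσ m)
    · exact mul_le_mul_of_nonneg_left (charlierSum_le hρ hσ m) (by positivity)
  refine sub_eq_zero.1 (balance_eq_zero hρ hσ ((summable_greenDiv hρ hσ).sub h_summable)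
    ?_ (fun m => ?_) m)
  · have h_exp : Real.exp (-ρ) * Real.exp ρ = 1 := by rw [← Real.exp_add]; simp
    simp only [pow_one, pow_zero, Nat.factorial_one, Nat.factorial_zero, Nat.cast_one, div_one]
    linear_combination greenDiv_one hρ hσ - Real.exp (-ρ) * charlierSum_one hρ hσ + h_exp
  · have h_green := greenDiv_add_two hρ hσ m
    have h_charlier := charlierSum_add_two hρ hσ m
    have h_fact : (m.factorial : ℝ) ≠ 0 := by positivity
    have h_two : (m : ℝ) + 2 ≠ 0 := by positivity
    have h_balance : ((m : ℝ) + 2) *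
        (ρ ^ (m + 2) / (m + 2).factorial * Real.exp (-ρ) * charlierSum ρ σ (m + 2)) =
        (m + 1 + σ + ρ) *
          (ρ ^ (m + 1) / (m + 1).factorial * Real.exp (-ρ) * charlierSum ρ σ (m + 1)) -
        ρ * (ρ ^ m / m.factorial * Real.exp (-ρ) * charlierSum ρ σ m) := by
      have h_factor : ((m : ℝ) + 2) * (ρ ^ (m + 2) / (m + 2).factorial) =
          ρ ^ (m + 1) / (m + 1).factorial * ρ := by
        rw [Nat.factorial_succ (m + 1), pow_succ ρ (m + 1)]
        push_cast
        field_simp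
        ring
      have h_factor' : ρ * (ρ ^ m / m.factorial) =
          ρ ^ (m + 1) / (m + 1).factorial * (m + 1) := by
        rw [Nat.factorial_succ, pow_succ]
        push_cast
        field_simp
      linear_combination Real.exp (-ρ) * charlierSum ρ σ (m + 2) * h_factor +
        ρ ^ (m + 1) / (m + 1).factorial * Real.exp (-ρ) * h_charlier +
        Real.exp (-ρ) * charlierSum ρ σ m * h_factor'
    linear_combination h_green - h_balance

/-- the probability that the number `ν(σ)` of customers in the initially empty
`M/M/∞` queue equals `m` when the observer leaves, expressed via Charlier polynomials. -/
theorem prob_nu_eq (ρ σ : ℝ) (hρ : 0 < ρ) (hσ : 0 < σ) (m : ℕ) :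
    Summable (fun k : ℕ => pchain ρ σ k m) ∧
      σ / ((m : ℝ) + σ + ρ) * ∑' k : ℕ, pchain ρ σ k m =
        σ * (ρ ^ m / m.factorial) * Real.exp (-ρ) *
          ∑' n : ℕ, charlier ρ (n : ℝ) m / (σ + n) * ρ ^ n / n.factorial := by
  refine ⟨summable_pchain hρ hσ m, ?_⟩
  have h_series : ∑' n : ℕ, charlier ρ (n : ℝ) m / (σ + n) * ρ ^ n / n.factorial =
      charlierSum ρ σ m := by
    unfold charlierSum charlierTerm
    congr 1 with n
    ring
  have h_ne : (m : ℝ) + σ + ρ ≠ 0 := by positivity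
  rw [h_series, tsum_pchain hρ hσ, greenDiv_eq hρ hσ]
  field_simp
end

section
/- Let ρ > 0, σ > 0 and 0 < z < 1. Then ∫_0^∞ σ·z·e^{ρz(1−z)(1−e^{−t}) − ρ(1−z²)t} · e^{−σt} dt = σ·z·e^{ρz(1−z)} · Σ_{n=0}^∞ (1/(σ+ρ+n−ρz²)) · (−ρz(1−z))^n/n!. (This is the Laplace-transform identity showing that the generating function of the number K(t) of arrivals and departures in an initially empty M/M/∞ system up to time t equals z·e^{ρz(1−z)(1−e^{−t}) − ρ(1−z²)t}.) -/
open MeasureTheory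

/-- The Laplace transform at `c > 0` of `t ↦ exp (a * exp (-t))`, as a series. -/
theorem hasSum_integral_exp_mul_exp_neg (a : ℝ) {c : ℝ} (hc : 0 < c) :
    HasSum (fun n : ℕ => 1 / (c + n) * a ^ n / n.factorial)
      (∫ t in Set.Ioi (0 : ℝ), Real.exp (a * Real.exp (-t)) * Real.exp (-c * t)) := by
  have hneg (n : ℕ) : -(c + n) < 0 := by
    have : (0 : ℝ) ≤ n := n.cast_nonneg
    linarith
  have hint (n : ℕ) : ∫ t in Set.Ioi (0 : ℝ), Real.exp (-(c + n) * t) = 1 / (c + n) := by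
    rw [integral_exp_mul_Ioi (hneg n)]
    rw [mul_zero, Real.exp_zero, neg_div_neg_eq]
  have key := hasSum_integral_of_summable_integral_norm
    (μ := volume.restrict (Set.Ioi (0 : ℝ)))
    (F := fun (n : ℕ) t => a ^ n / n.factorial * Real.exp (-(c + n) * t))
    (fun n => (integrableOn_exp_mul_Ioi (hneg n) 0).const_mul _) ?_
  · convert! key using 1
    · ext n
      rw [integral_const_mul, hint]
      ring
    · refine integral_congr_ae (.of_forall fun t => ?_)
      have h := (NormedSpace.expSeries_div_hasSum_exp (a * Real.exp (-t))).mul_right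
        (Real.exp (-c * t))
      rw [← Real.exp_eq_exp_ℝ] at h
      refine h.tsum_eq.symm.trans (tsum_congr fun n => ?_)
      rw [mul_pow, ← Real.exp_nat_mul, mul_div_right_comm, mul_assoc, ← Real.exp_add]
      congr 2
      ring
  · simp_rw [norm_mul, Real.norm_of_nonneg (Real.exp_pos _).le, integral_const_mul, hint]
    refine Summable.of_nonneg_of_le (fun n => ?_) (fun n => ?_)
      ((Real.summable_pow_div_factorial |a|).mul_right (1 / c))
    · have := hneg n
      exact mul_nonneg (norm_nonneg _) (one_div_nonneg.2 (by linarith))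
    · have : (0 : ℝ) ≤ n := n.cast_nonneg
      rw [norm_div, norm_pow, Real.norm_eq_abs, Real.norm_natCast]
      gcongr
      linarith

/-- Laplace-transform identity showing that the generating function of the number
`K(t)` of arrivals and departures in an initially empty `M/M/∞` system up to time `t` equals
`z·e^{ρz(1−z)(1−e^{−t}) − ρ(1−z²)t}`. -/
theorem laplace_genFun_K (ρ σ z : ℝ) (hρ : 0 < ρ) (hσ : 0 < σ) (hz0 : 0 < z) (hz1 : z < 1) :
    ∫ t in Set.Ioi (0 : ℝ),
        σ * z * Real.exp (ρ * z * (1 - z) * (1 - Real.exp (-t)) - ρ * (1 - z ^ 2) * t) *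
          Real.exp (-σ * t) =
      σ * z * Real.exp (ρ * z * (1 - z)) *
        ∑' n : ℕ, 1 / (σ + ρ + n - ρ * z ^ 2) * (-(ρ * z * (1 - z))) ^ n / n.factorial := by
  have hc : 0 < σ + ρ - ρ * z ^ 2 := by
    have : 0 < ρ * (1 - z ^ 2) := mul_pos hρ (by nlinarith)
    linarith
  simp_rw [add_sub_right_comm (σ + ρ)]
  rw [(hasSum_integral_exp_mul_exp_neg _ hc).tsum_eq, ← integral_const_mul]
  congr 1 with t
  simp only [mul_assoc, ← Real.exp_add]
  congr 3
  ring
end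

section
/- Let ρ > 0, σ > 0 and 0 ≤ z ≤ 1. Then σ · ∫_0^∞ e^{ρ(1−z)(1−e^{−t}−t)} · e^{−σt} dt = (σ/(σ+ρ(1−z))) · Φ(1, σ+ρ(1−z)+1; ρ(1−z)). (This Laplace-transform identity shows that the number D(t) of departures from an initially empty M/M/∞ queue up to time t has generating function e^{ρ(1−z)(1−e^{−t}−t)}, i.e., D(t) is Poisson with mean ρ(e^{−t}−1+t).) -/
open MeasureTheory

theorem ascPochhammer_eval_succ_left (s : ℝ) (n : ℕ) :
    (ascPochhammer ℝ (n + 1)).eval s = s * (ascPochhammer ℝ n).eval (s + 1) := by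
  simp [ascPochhammer_succ_left, Polynomial.eval_comp]

/-- The beta integral `∫₀^∞ (1 - e^{-t})ⁿ e^{-st} dt = n! / (s)_{n+1}`, with integrability. -/
theorem integral_one_sub_exp_pow_mul_exp (n : ℕ) : ∀ s : ℝ, 0 < s →
    IntegrableOn (fun t => (1 - Real.exp (-t)) ^ n * Real.exp (-s * t)) (Set.Ioi 0) ∧
    ∫ t in Set.Ioi (0 : ℝ), (1 - Real.exp (-t)) ^ n * Real.exp (-s * t) =
      n.factorial / (ascPochhammer ℝ (n + 1)).eval s := by
  induction n with
  | zero =>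
    intro s hs
    refine ⟨by simpa using integrableOn_exp_mul_Ioi (neg_lt_zero.mpr hs) 0, ?_⟩
    simp only [pow_zero, one_mul]
    rw [integral_exp_mul_Ioi (neg_lt_zero.mpr hs)]
    simp
  | succ n ih =>
    intro s hs
    obtain ⟨hi, he⟩ := ih s hs
    obtain ⟨hi', he'⟩ := ih (s + 1) (by positivity)
    have hfun : (fun t : ℝ => (1 - Real.exp (-t)) ^ (n + 1) * Real.exp (-s * t)) =
        fun t => (1 - Real.exp (-t)) ^ n * Real.exp (-s * t) -
          (1 - Real.exp (-t)) ^ n * Real.exp (-(s + 1) * t) := by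
      funext t
      rw [show -(s + 1) * t = -t + -s * t by ring, Real.exp_add]
      ring
    rw [hfun]
    refine ⟨hi.sub hi', ?_⟩
    rw [integral_sub hi hi', he, he']
    have hp : 0 < (ascPochhammer ℝ n).eval (s + 1) := ascPochhammer_pos n _ (by positivity)
    rw [ascPochhammer_eval_succ_left s (n + 1), ascPochhammer_eval_succ_left s n,
      ascPochhammer_succ_eval, Nat.factorial_succ]
    have hn : 0 < s + 1 + (n : ℝ) := by positivity
    push_cast
    field_simp
    ring

/-- The Laplace transform of `exp (c (1 - e^{-t}))` is a Kummer function. -/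
theorem integral_exp_mul_one_sub_exp_mul_exp {c s : ℝ} (hc : 0 ≤ c) (hs : 0 < s) :
    ∫ t in Set.Ioi (0 : ℝ), Real.exp (c * (1 - Real.exp (-t))) * Real.exp (-s * t) =
      1 / s * kummerPhi 1 (s + 1) c := by
  have hsum (x : ℝ) : HasSum (fun n : ℕ => x ^ n / n.factorial) (Real.exp x) := by
    rw [Real.exp_eq_exp_ℝ]
    exact NormedSpace.expSeries_div_hasSum_exp x
  have hint : IntegrableOn (fun t => Real.exp (-s * t)) (Set.Ioi 0) :=
    integrableOn_exp_mul_Ioi (neg_lt_zero.mpr hs) 0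
  have key := hasSum_integral_of_dominated_convergence (μ := volume.restrict (Set.Ioi (0 : ℝ)))
    (F := fun (n : ℕ) t => (c * (1 - Real.exp (-t))) ^ n / n.factorial * Real.exp (-s * t))
    (f := fun t => Real.exp (c * (1 - Real.exp (-t))) * Real.exp (-s * t))
    (fun n t => c ^ n / n.factorial * Real.exp (-s * t))
    (fun n => Continuous.aestronglyMeasurable (by fun_prop))
    (fun n => by
      filter_upwards [ae_restrict_mem measurableSet_Ioi] with t ht
      have ht : 0 < t := ht
      have h1 : 0 ≤ 1 - Real.exp (-t) := by
        rw [sub_nonneg, Real.exp_le_one_iff]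
        linarith
      have h2 : c * (1 - Real.exp (-t)) ≤ c :=
        mul_le_of_le_one_right hc (by linarith [Real.exp_pos (-t)])
      rw [Real.norm_of_nonneg (by positivity)]
      gcongr)
    (.of_forall fun t => (hsum c).summable.mul_right _)
    (by
      simp_rw [tsum_mul_right]
      exact hint.const_mul _)
    (.of_forall fun t => (hsum _).mul_right _)
  rw [← key.tsum_eq, kummerPhi, ← tsum_mul_left]
  congr 1 with n
  have hp : 0 < (ascPochhammer ℝ n).eval (s + 1) := ascPochhammer_pos n _ (by positivity)
  have hF : (fun t : ℝ => (c * (1 - Real.exp (-t))) ^ n / n.factorial * Real.exp (-s * t)) =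
      fun t => c ^ n / n.factorial * ((1 - Real.exp (-t)) ^ n * Real.exp (-s * t)) := by
    funext t
    rw [mul_pow]
    ring
  rw [hF, integral_const_mul, (integral_one_sub_exp_pow_mul_exp n s hs).2,
    ascPochhammer_eval_succ_left, ascPochhammer_eval_one]
  field_simp

/-- Laplace-transform identity showing that the number `D(t)` of departures from
an initially empty `M/M/∞` queue up to time `t` has generating function
`e^{ρ(1−z)(1−e^{−t}−t)}`, i.e. `D(t)` is Poisson with mean `ρ(e^{−t}−1+t)`. -/
theorem laplace_genFun_D (ρ σ z : ℝ) (hρ : 0 < ρ) (hσ : 0 < σ) (hz0 : 0 ≤ z) (hz1 : z ≤ 1) :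
    σ * ∫ t in Set.Ioi (0 : ℝ),
        Real.exp (ρ * (1 - z) * (1 - Real.exp (-t) - t)) * Real.exp (-σ * t) =
      σ / (σ + ρ * (1 - z)) * kummerPhi 1 (σ + ρ * (1 - z) + 1) (ρ * (1 - z)) := by
  have hc : 0 ≤ ρ * (1 - z) := mul_nonneg hρ.le (sub_nonneg.mpr hz1)
  have hfun : (fun t : ℝ => Real.exp (ρ * (1 - z) * (1 - Real.exp (-t) - t)) *
      Real.exp (-σ * t)) = fun t => Real.exp (ρ * (1 - z) * (1 - Real.exp (-t))) *
        Real.exp (-(σ + ρ * (1 - z)) * t) := by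
    funext t
    rw [← Real.exp_add, ← Real.exp_add]
    congr 1
    ring
  rw [hfun, integral_exp_mul_one_sub_exp_mul_exp hc (by positivity)]
  ring
end

section
/- Let ρ > 0, σ > 0 and let c ≥ 1 be an integer. A real number x is an eigenvalue of the matrix A^[c](σ) (i.e., there exists a nonzero vector v ∈ ℝ^{c+1} with A^[c](σ)·v = x·v) if and only if P_{c+1}(σ;x) = x·P_c(σ;x). -/
/-- The `(c+1)×(c+1)` substochastic transition matrix `A^[c](σ)` of the absorbed chain of the
`M/M/c/c` queue: superdiagonal `ρ/(n+σ+ρ)` for `n < c`, subdiagonal `n/(n+σ+ρ)` for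
`1 ≤ n < c`, and `c/(c+σ)` at `(c,c−1)`. -/
noncomputable def Amat (ρ σ : ℝ) (c : ℕ) : Matrix (Fin (c + 1)) (Fin (c + 1)) ℝ :=
  Matrix.of fun i j =>
    if (j : ℕ) = (i : ℕ) + 1 then ρ / ((i : ℕ) + σ + ρ)
    else if (j : ℕ) + 1 = (i : ℕ) then
      (if (i : ℕ) = c then (c : ℝ) / ((c : ℝ) + σ) else (i : ℕ) / ((i : ℕ) + σ + ρ))
    else 0

theorem Ppoly_add_two {ρ : ℝ} (hρ : ρ ≠ 0) (σ x : ℝ) (n : ℕ) :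
    ρ * Ppoly ρ σ x (n + 2) =
      ((n : ℝ) + 1 + σ + ρ) * x * Ppoly ρ σ x (n + 1) - ((n : ℝ) + 1) * Ppoly ρ σ x n := by
  rw [Ppoly]
  field_simp

theorem Amat_mulVec_zero (ρ σ : ℝ) (m : ℕ) (w : ℕ → ℝ) (h : 0 < m + 1 + 1) :
    (Amat ρ σ (m + 1)).mulVec (fun j => w j) ⟨0, h⟩ = ρ / (σ + ρ) * w 1 := by
  simp only [Matrix.mulVec, dotProduct, Amat, Matrix.of_apply]
  rw [Fin.sum_univ_eq_sum_range (fun j => (if j = 0 + 1 then ρ / (((0 : ℕ) : ℝ) + σ + ρ)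
    else if j + 1 = 0 then _ else 0) * w j), Finset.sum_eq_single 1]
  · simp
  · intro j _ hj
    simp [hj]
  · simp

theorem Amat_mulVec_succ (ρ σ : ℝ) (m : ℕ) (w : ℕ → ℝ) {n : ℕ} (hn : n < m)
    (h : n + 1 < m + 1 + 1) :
    (Amat ρ σ (m + 1)).mulVec (fun j => w j) ⟨n + 1, h⟩ =
      (ρ * w (n + 2) + ((n : ℝ) + 1) * w n) / ((n : ℝ) + 1 + σ + ρ) := by
  simp only [Matrix.mulVec, dotProduct, Amat, Matrix.of_apply]
  rw [Fin.sum_univ_eq_sum_range (fun j => (if j = n + 1 + 1 then _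
    else if j + 1 = n + 1 then _ else 0) * w j),
    Finset.sum_eq_add_of_mem (n + 2) n (by simp; omega) (by simp; omega) (by omega)]
  · simp [hn.ne, show n ≠ n + 1 + 1 by omega]
    ring
  · intro j _ hj
    rw [if_neg (by omega), if_neg (by omega), zero_mul]

theorem Amat_mulVec_last (ρ σ : ℝ) (m : ℕ) (w : ℕ → ℝ) (h : m + 1 < m + 1 + 1) :
    (Amat ρ σ (m + 1)).mulVec (fun j => w j) ⟨m + 1, h⟩ =
      ((m : ℝ) + 1) / ((m : ℝ) + 1 + σ) * w m := by
  simp only [Matrix.mulVec, dotProduct, Amat, Matrix.of_apply]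
  rw [Fin.sum_univ_eq_sum_range (fun j => (if j = m + 1 + 1 then _
    else if j + 1 = m + 1 then _ else 0) * w j), Finset.sum_eq_single m]
  · simp [show m ≠ m + 1 + 1 by omega]
  · intro j hj hjm
    rw [Finset.mem_range] at hj
    rw [if_neg (by omega), if_neg (by omega), zero_mul]
  · simp

/-- The eigenvalue equation for `A^[m+1](σ)`, written row by row. -/
theorem Amat_mulVec_eq_smul_iff {ρ σ : ℝ} (hρ : 0 < ρ) (hσ : 0 < σ) (m : ℕ) (x : ℝ)
    (w : ℕ → ℝ) :
    (Amat ρ σ (m + 1)).mulVec (fun j => w j) = x • (fun j : Fin (m + 1 + 1) => w j) ↔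
      ρ * w 1 = (σ + ρ) * x * w 0 ∧
      (∀ n < m, ρ * w (n + 2) = ((n : ℝ) + 1 + σ + ρ) * x * w (n + 1) - ((n : ℝ) + 1) * w n) ∧
      ((m : ℝ) + 1) * w m = ((m : ℝ) + 1 + σ) * x * w (m + 1) := by
  have zero_iff : ρ / (σ + ρ) * w 1 = x * w 0 ↔ ρ * w 1 = (σ + ρ) * x * w 0 := by
    rw [div_mul_eq_mul_div, div_eq_iff (by positivity)]
    ring_nf
  have succ_iff (n : ℕ) : (ρ * w (n + 2) + ((n : ℝ) + 1) * w n) / ((n : ℝ) + 1 + σ + ρ) =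
      x * w (n + 1) ↔
      ρ * w (n + 2) = ((n : ℝ) + 1 + σ + ρ) * x * w (n + 1) - ((n : ℝ) + 1) * w n := by
    rw [div_eq_iff (by positivity), eq_sub_iff_add_eq]
    ring_nf
  have last_iff : ((m : ℝ) + 1) / ((m : ℝ) + 1 + σ) * w m = x * w (m + 1) ↔
      ((m : ℝ) + 1) * w m = ((m : ℝ) + 1 + σ) * x * w (m + 1) := by
    rw [div_mul_eq_mul_div, div_eq_iff (by positivity)]
    ring_nf
  rw [← zero_iff, ← last_iff]
  simp only [← succ_iff]
  constructor
  · intro h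
    refine ⟨?_, fun n hn => ?_, ?_⟩
    · rw [← Amat_mulVec_zero ρ σ m w (by omega), h]
      simp
    · rw [← Amat_mulVec_succ ρ σ m w hn (by omega), h]
      simp
    · rw [← Amat_mulVec_last ρ σ m w (by omega), h]
      simp
  · rintro ⟨h0, hs, hl⟩
    funext ⟨i, hi⟩
    rcases i with _ | n
    · rw [Amat_mulVec_zero, h0]
      simp
    · rcases (show n < m ∨ n = m by omega) with hn | rfl
      · rw [Amat_mulVec_succ ρ σ m w hn, hs n hn]
        simp
      · rw [Amat_mulVec_last, hl]
        simp

/-- A solution of the three-term recurrence is determined by its initial value. -/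
theorem eq_mul_Ppoly_of_recurrence {ρ σ x : ℝ} (hρ : ρ ≠ 0) {m : ℕ} {w : ℕ → ℝ}
    (h0 : ρ * w 1 = (σ + ρ) * x * w 0)
    (hs : ∀ n < m, ρ * w (n + 2) =
      ((n : ℝ) + 1 + σ + ρ) * x * w (n + 1) - ((n : ℝ) + 1) * w n) :
    ∀ n ≤ m + 1, w n = w 0 * Ppoly ρ σ x n := by
  intro n
  induction n using Nat.twoStepInduction with
  | zero => simp [Ppoly]
  | one =>
    intro _
    rw [Ppoly]
    field_simp
    linarith
  | more n ih ih' =>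
    intro hn
    apply mul_left_cancel₀ hρ
    rw [hs n (by omega), ih (by omega), ih' (by omega)]
    linear_combination -w 0 * Ppoly_add_two hρ σ x n

/-- Given the recurrence, the condition at the last row is `P_{m+2} = x·P_{m+1}`. -/
theorem Ppoly_last_row_iff {ρ : ℝ} (hρ : ρ ≠ 0) (σ x : ℝ) (m : ℕ) :
    ((m : ℝ) + 1) * Ppoly ρ σ x m = ((m : ℝ) + 1 + σ) * x * Ppoly ρ σ x (m + 1) ↔
      Ppoly ρ σ x (m + 2) = x * Ppoly ρ σ x (m + 1) := by
  have h := Ppoly_add_two hρ σ x m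
  constructor <;> intro h'
  · apply mul_left_cancel₀ hρ
    linear_combination h - h'
  · linear_combination h - ρ * h'

/-- `x` is an eigenvalue of `A^[c](σ)` iff `P_{c+1}(σ;x) = x·P_c(σ;x)`. -/
theorem eigenvalue_Amat_iff (ρ σ : ℝ) (hρ : 0 < ρ) (hσ : 0 < σ) (c : ℕ) (hc : 1 ≤ c) (x : ℝ) :
    (∃ v : Fin (c + 1) → ℝ, v ≠ 0 ∧ (Amat ρ σ c).mulVec v = x • v) ↔
      Ppoly ρ σ x (c + 1) = x * Ppoly ρ σ x c := by
  obtain ⟨m, rfl⟩ := Nat.exists_eq_add_of_le' hc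
  rw [← Ppoly_last_row_iff hρ.ne']
  constructor
  · rintro ⟨v, hv, h⟩
    obtain ⟨w, rfl⟩ : ∃ w : ℕ → ℝ, v = fun j : Fin (m + 1 + 1) => w j :=
      ⟨fun n => if hn : n < m + 1 + 1 then v ⟨n, hn⟩ else 0, by ext j; simp [j.isLt]⟩
    obtain ⟨h0, hs, hl⟩ := (Amat_mulVec_eq_smul_iff hρ hσ m x w).1 h
    have hw := eq_mul_Ppoly_of_recurrence hρ.ne' h0 hs
    have hw0 : w 0 ≠ 0 := by
      intro hz
      apply hv
      funext j
      simp [hw j (Nat.le_of_lt_succ j.isLt), hz]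
    rw [hw m (by omega), hw (m + 1) le_rfl] at hl
    apply mul_left_cancel₀ hw0
    linear_combination hl
  · intro h
    refine ⟨fun j => Ppoly ρ σ x j, fun hv => ?_,
      (Amat_mulVec_eq_smul_iff hρ hσ m x _).2
        ⟨?_, fun n _ => Ppoly_add_two hρ.ne' σ x n, h⟩⟩
    · simpa [Ppoly] using congrFun hv 0
    · simp only [Ppoly]
      field_simp
end

section
/- Let ρ > 0, σ > 0 and let c ≥ 1 be an integer. The equation P_{c+1}(σ;x) = x·P_c(σ;x) has exactly c+1 solutions in ℝ, all of which are simple and lie in the open interval (−1,1); equivalently, the degree-(c+1) polynomial x·P_c(σ;x) − P_{c+1}(σ;x) has c+1 distinct real roots, all in (−1,1). -/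
open Polynomial

/-- The sequence `Ppoly ρ σ x n`, as polynomials in `x`. -/
noncomputable def associatedPoly (ρ σ : ℝ) : ℕ → ℝ[X]
  | 0 => 1
  | 1 => C ((σ + ρ) / ρ) * X
  | n + 2 => C (((n : ℝ) + 1 + σ + ρ) / ρ) * X * associatedPoly ρ σ (n + 1) -
      C (((n : ℝ) + 1) / ρ) * associatedPoly ρ σ n

theorem eval_associatedPoly (ρ σ x : ℝ) (n : ℕ) :
    (associatedPoly ρ σ n).eval x = Ppoly ρ σ x n := by
  induction n using Nat.twoStepInduction with
  | zero => simp [associatedPoly, Ppoly]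
  | one => simp [associatedPoly, Ppoly]; ring
  | more n ih₀ ih₁ => simp [associatedPoly, Ppoly, ih₀, ih₁]; ring

/-- `p / q` maps the upper and the lower half-plane to themselves, and the Wronskian
of `q` and `p` is positive on the real line. -/
structure IsInterlacingPair (p q : ℝ[X]) : Prop where
  im_pos : ∀ z : ℂ, z.im ≠ 0 → 0 < z.im * (aeval z p * starRingEnd ℂ (aeval z q)).im
  wronskian_pos : ∀ x : ℝ,
    0 < p.derivative.eval x * q.eval x - p.eval x * q.derivative.eval x

namespace IsInterlacingPair

theorem C_mul_X_one {a : ℝ} (ha : 0 < a) : IsInterlacingPair (C a * X) 1 where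
  im_pos z hz := by
    have := mul_pos ha (mul_self_pos.2 hz)
    simp
    linarith
  wronskian_pos x := by simpa using ha

theorem step {p q : ℝ[X]} (h : IsInterlacingPair p q) {a b : ℝ} (ha : 0 < a) (hb : 0 < b) :
    IsInterlacingPair (C a * X * p - C b * q) p where
  im_pos z hz := by
    have h₁ := mul_pos hb (h.im_pos z hz)
    have h₂ := mul_nonneg (mul_nonneg ha.le (mul_self_nonneg z.im))
      (Complex.normSq_nonneg (aeval z p))
    simp [Complex.normSq_apply] at h₁ h₂ ⊢
    linarith
  wronskian_pos x := by
    have h₁ := mul_pos hb (h.wronskian_pos x)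
    have h₂ := mul_nonneg ha.le (mul_self_nonneg (p.eval x))
    simp
    linarith

theorem splits {p q : ℝ[X]} (h : IsInterlacingPair p q) : p.Splits := by
  refine Splits.of_splits_map (algebraMap ℝ ℂ) (IsAlgClosed.splits _) fun z hz => ?_
  have hz' : aeval z p = 0 := by
    simpa [aeval_def, eval_map] using (mem_roots'.1 hz).2
  have him : z.im = 0 := by
    by_contra hne
    simpa [hz'] using h.im_pos z hne
  exact ⟨z.re, Complex.ext (by simp) (by simp [him])⟩

theorem nodup_roots {p q : ℝ[X]} (h : IsInterlacingPair p q) : p.roots.Nodup := by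
  classical
  rw [Multiset.nodup_iff_count_le_one]
  intro x
  rw [count_roots]
  by_contra! hlt
  have hp : p ≠ 0 := by
    rintro rfl
    simp at hlt
  obtain ⟨h₀, h₁⟩ := (one_lt_rootMultiplicity_iff_isRoot hp).1 hlt
  simpa [h₀.eq_zero, h₁.eq_zero] using h.wronskian_pos x

theorem card_roots_toFinset {p q : ℝ[X]} (h : IsInterlacingPair p q) :
    p.roots.toFinset.card = p.natDegree := by
  rw [Multiset.toFinset_card_of_nodup h.nodup_roots, h.splits.natDegree_eq_card_roots]

end IsInterlacingPair

theorem degree_C_mul_X_mul_sub {p q : ℝ[X]} {n m : ℕ} (hp : p.degree = n) (hq : q.degree = m)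
    (hmn : m ≤ n) {a : ℝ} (ha : a ≠ 0) (b : ℝ) :
    (C a * X * p - C b * q).degree = ((n + 1 : ℕ) : WithBot ℕ) := by
  have h₁ : (C a * X * p).degree = ((n + 1 : ℕ) : WithBot ℕ) := by
    rw [degree_mul, degree_C_mul_X ha, hp, add_comm]
    rfl
  rw [degree_sub_eq_left_of_degree_lt, h₁]
  rw [h₁, ← smul_eq_C_mul]
  refine (degree_smul_le b q).trans_lt ?_
  rw [hq]
  exact_mod_cast Nat.lt_succ_of_le hmn

theorem degree_associatedPoly {ρ σ : ℝ} (hρ : 0 < ρ) (hσ : 0 < σ) (n : ℕ) :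
    (associatedPoly ρ σ n).degree = n := by
  induction n using Nat.twoStepInduction with
  | zero => simp [associatedPoly]
  | one =>
    have : (σ + ρ) / ρ ≠ 0 := by positivity
    simpa [associatedPoly] using degree_C_mul_X this
  | more n ih₀ ih₁ =>
    exact degree_C_mul_X_mul_sub ih₁ ih₀ n.le_succ (by positivity) _

theorem isInterlacingPair_associatedPoly {ρ σ : ℝ} (hρ : 0 < ρ) (hσ : 0 < σ)
    (n : ℕ) :
    IsInterlacingPair (associatedPoly ρ σ (n + 1)) (associatedPoly ρ σ n) := by
  induction n with
  | zero => exact .C_mul_X_one (by positivity)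
  | succ n ih => exact ih.step (by positivity) (by positivity)

theorem Ppoly_pos_and_le_succ {ρ σ : ℝ} (hρ : 0 < ρ) (hσ : 0 < σ)
    {x : ℝ} (hx : 1 ≤ x) (n : ℕ) :
    0 < Ppoly ρ σ x n ∧ Ppoly ρ σ x n ≤ Ppoly ρ σ x (n + 1) := by
  induction n with
  | zero =>
    refine ⟨by simp [Ppoly], ?_⟩
    simp only [Ppoly]
    rw [le_div_iff₀ hρ]
    nlinarith
  | succ n ih =>
    obtain ⟨h₀, h₁⟩ := ih
    have h₂ := h₀.trans_le h₁
    refine ⟨h₂, ?_⟩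
    rw [Ppoly, le_div_iff₀ hρ]
    have h₃ : ((n : ℝ) + 1 + σ + ρ) * 1 * Ppoly ρ σ x (n + 1) ≤
        ((n : ℝ) + 1 + σ + ρ) * x * Ppoly ρ σ x (n + 1) := by gcongr
    have h₄ : ((n : ℝ) + 1) * Ppoly ρ σ x n ≤ ((n : ℝ) + 1) * Ppoly ρ σ x (n + 1) := by gcongr
    nlinarith [mul_pos hσ h₂]

theorem mul_Ppoly_sub_pos {ρ σ : ℝ} (hρ : 0 < ρ) (hσ : 0 < σ)
    {x : ℝ} (hx : 1 ≤ x) (n : ℕ) :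
    0 < ((n : ℝ) + 1 + σ) * x * Ppoly ρ σ x (n + 1) - ((n : ℝ) + 1) * Ppoly ρ σ x n := by
  obtain ⟨h₀, h₁⟩ := Ppoly_pos_and_le_succ hρ hσ hx n
  have h₂ := h₀.trans_le h₁
  have h₃ : ((n : ℝ) + 1 + σ) * 1 * Ppoly ρ σ x (n + 1) ≤
      ((n : ℝ) + 1 + σ) * x * Ppoly ρ σ x (n + 1) := by gcongr
  have h₄ : ((n : ℝ) + 1) * Ppoly ρ σ x n ≤ ((n : ℝ) + 1) * Ppoly ρ σ x (n + 1) := by gcongr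
  nlinarith [mul_pos hσ h₂]

theorem Ppoly_neg (ρ σ x : ℝ) (n : ℕ) : Ppoly ρ σ (-x) n = (-1) ^ n * Ppoly ρ σ x n := by
  induction n using Nat.twoStepInduction with
  | zero => simp [Ppoly]
  | one => simp [Ppoly]; ring
  | more n ih₀ ih₁ => simp only [Ppoly, ih₀, ih₁]; ring

theorem Ppoly_eq_mul_iff {ρ : ℝ} (hρ : ρ ≠ 0) (σ x : ℝ) (n : ℕ) :
    Ppoly ρ σ x (n + 2) = x * Ppoly ρ σ x (n + 1) ↔
      ((n : ℝ) + 1 + σ) * x * Ppoly ρ σ x (n + 1) - ((n : ℝ) + 1) * Ppoly ρ σ x n = 0 := by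
  rw [Ppoly, div_eq_iff hρ, ← sub_eq_zero]
  ring_nf

/-- the equation `P_{c+1}(σ;x) = x·P_c(σ;x)` has exactly `c+1` real solutions,
all simple and lying in the open interval `(−1,1)`: the degree-`(c+1)` polynomial
`x·P_c(σ;x) − P_{c+1}(σ;x)` has `c+1` distinct real roots, all in `(−1,1)`. -/
theorem roots_of_eigen_equation (ρ σ : ℝ) (hρ : 0 < ρ) (hσ : 0 < σ) (c : ℕ) (hc : 1 ≤ c) :
    ∃ S : Finset ℝ, S.card = c + 1 ∧ (∀ x ∈ S, x ∈ Set.Ioo (-1 : ℝ) 1) ∧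
      ∀ x : ℝ, (Ppoly ρ σ x (c + 1) = x * Ppoly ρ σ x c ↔ x ∈ S) := by
  obtain ⟨n, rfl⟩ := Nat.exists_eq_add_of_le' hc
  set p : ℝ[X] := C ((n : ℝ) + 1 + σ) * X * associatedPoly ρ σ (n + 1) -
    C ((n : ℝ) + 1) * associatedPoly ρ σ n with hp
  have hpair : IsInterlacingPair p (associatedPoly ρ σ (n + 1)) :=
    (isInterlacingPair_associatedPoly hρ hσ n).step (by positivity) (by positivity)
  have hdeg : p.degree = ((n + 1 + 1 : ℕ) : WithBot ℕ) :=
    degree_C_mul_X_mul_sub (degree_associatedPoly hρ hσ _) (degree_associatedPoly hρ hσ _)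
      n.le_succ (by positivity) _
  have hp₀ : p ≠ 0 := by
    rw [← degree_ne_bot, hdeg]
    exact WithBot.coe_ne_bot
  have heval (x : ℝ) : p.eval x =
      ((n : ℝ) + 1 + σ) * x * Ppoly ρ σ x (n + 1) - ((n : ℝ) + 1) * Ppoly ρ σ x n := by
    simp [hp, eval_associatedPoly]
  have hneg (x : ℝ) : p.eval (-x) = (-1) ^ n * p.eval x := by
    rw [heval, heval, Ppoly_neg, Ppoly_neg]
    ring
  have hpos {x : ℝ} (hx : 1 ≤ x) : p.eval x ≠ 0 := by
    rw [heval]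
    exact (mul_Ppoly_sub_pos hρ hσ hx n).ne'
  refine ⟨p.roots.toFinset, ?_, fun x hx => ?_, fun x => ?_⟩
  · rw [hpair.card_roots_toFinset, natDegree_eq_of_degree_eq_some hdeg]
  · have hx₀ : p.eval x = 0 := by simpa [hp₀] using hx
    constructor
    · by_contra! hle
      exact hpos (le_neg_of_le_neg hle) (by rw [hneg, hx₀, mul_zero])
    · by_contra! hle
      exact hpos hle hx₀
  · rw [Ppoly_eq_mul_iff hρ.ne', ← heval]
    simp [hp₀]
end

section
/- Let ρ > 0, σ > 0, let c ≥ 1 be an integer, and let z be a real number with P_{c+1}(σ;z) ≠ z·P_c(σ;z). Then the matrix z·I − A^[c](σ) is invertible and, for every 0 ≤ m ≤ c, the m-th component of (z·I − A^[c](σ))^{−1}·e_0 equals −P*_m(σ;z) + ((P*_{c+1}(σ;z) − z·P*_c(σ;z))/(P_{c+1}(σ;z) − z·P_c(σ;z))) · P_m(σ;z), where e_0 ∈ ℝ^{c+1} is the standard basis vector with first component 1. In particular the (0,0) entry of the resolvent equals (P*_{c+1}(σ;z) − z·P*_c(σ;z))/(P_{c+1}(σ;z) − z·P_c(σ;z)).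 -/
/-- Rows of `z • 1 - Amat ρ σ c` acting on the restriction of a sequence. -/
theorem resolvent_mulVec_apply (ρ σ z : ℝ) {c : ℕ} (hc : 1 ≤ c) (f : ℕ → ℝ) (i : Fin (c + 1)) :
    (z • (1 : Matrix (Fin (c + 1)) (Fin (c + 1)) ℝ) - Amat ρ σ c).mulVec (fun j => f j) i =
      z * f i - (if (i : ℕ) < c then ρ / ((i : ℕ) + σ + ρ) * f (i + 1) else 0) -
        (if (i : ℕ) = c then (c : ℝ) / ((c : ℝ) + σ) else (i : ℕ) / ((i : ℕ) + σ + ρ)) *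
          f (i - 1) := by
  obtain ⟨n, hn⟩ := i
  have hA : (Amat ρ σ c).mulVec (fun j => f j) ⟨n, hn⟩ =
      (if n < c then ρ / (n + σ + ρ) * f (n + 1) else 0) +
        (if n = c then (c : ℝ) / ((c : ℝ) + σ) else n / (n + σ + ρ)) * f (n - 1) := by
    have hsplit : ∀ (a b : ℝ) (j : ℕ),
        (if j = n + 1 then a else if j + 1 = n then b else 0) * f j =
          (if j = n + 1 then a * f j else 0) + (if j + 1 = n then b * f j else 0) := by
      intro a b j
      split_ifs <;> first | omega | ring
    simp only [Matrix.mulVec, dotProduct, Amat, Matrix.of_apply, hsplit]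
    rw [Fin.sum_univ_eq_sum_range (fun j => (if j = n + 1 then ρ / ((n : ℝ) + σ + ρ) * f j else 0) +
      (if j + 1 = n then (if n = c then (c : ℝ) / ((c : ℝ) + σ) else n / ((n : ℝ) + σ + ρ)) * f j
        else 0)) (c + 1), Finset.sum_add_distrib]
    congr 1
    · simp
    · cases n with
      | zero => simp [show 0 ≠ c by omega]
      | succ k =>
        simp only [Nat.add_right_cancel_iff, Finset.sum_ite_eq', Finset.mem_range,
          Nat.add_sub_cancel]
        rw [if_pos (by omega)]
  rw [Matrix.sub_mulVec, Pi.sub_apply, hA, Matrix.smul_mulVec, Matrix.one_mulVec]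
  simp only [Pi.smul_apply, smul_eq_mul]
  ring

/-- A sequence killed by all rows of `z • 1 - Amat ρ σ c` but the last is a multiple of `Ppoly`. -/
theorem eq_mul_Ppoly {ρ σ z : ℝ} (hρ : 0 < ρ) (hσ : 0 < σ) {c : ℕ} {f : ℕ → ℝ}
    (h : ∀ n < c, z * f n - ρ / (n + σ + ρ) * f (n + 1) - n / (n + σ + ρ) * f (n - 1) = 0) :
    ∀ n ≤ c, f n = f 0 * Ppoly ρ σ z n
  | 0, _ => by simp [Ppoly]
  | 1, hn => by
    have h0 := h 0 (by omega)
    have : σ + ρ ≠ 0 := by positivity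
    simp only [Ppoly]
    field_simp at h0 ⊢
    simp at h0
    linarith
  | n + 2, hn => by
    have h1 := h (n + 1) (by omega)
    have e0 := eq_mul_Ppoly hρ hσ h n (by omega)
    have e1 := eq_mul_Ppoly hρ hσ h (n + 1) (by omega)
    have : (n : ℝ) + 1 + σ + ρ ≠ 0 := by positivity
    simp only [Ppoly]
    push_cast at h1
    rw [e1, e0] at h1
    field_simp at h1 ⊢
    linarith

/-- The three-term recurrence turns the last row into a boundary term. -/
theorem last_row_eq {ρ σ z : ℝ} (hρ : 0 < ρ) (hσ : 0 < σ) (n : ℕ) {a b d : ℝ}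
    (h : d = (((n : ℝ) + 1 + σ + ρ) * z * b - ((n : ℝ) + 1) * a) / ρ) :
    z * b - ((n : ℝ) + 1) / ((n : ℝ) + 1 + σ) * a = ρ / ((n : ℝ) + 1 + σ) * (d - z * b) := by
  have : (n : ℝ) + 1 + σ ≠ 0 := by positivity
  subst h
  field_simp
  ring

/-- explicit form of the resolvent of `A^[c](σ)` applied to `e_0`. -/
theorem resolvent_Amat (ρ σ : ℝ) (hρ : 0 < ρ) (hσ : 0 < σ) (c : ℕ) (hc : 1 ≤ c) (z : ℝ)
    (hz : Ppoly ρ σ z (c + 1) ≠ z * Ppoly ρ σ z c) :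
    IsUnit (z • (1 : Matrix (Fin (c + 1)) (Fin (c + 1)) ℝ) - Amat ρ σ c) ∧
      (∀ m : Fin (c + 1),
        (z • (1 : Matrix (Fin (c + 1)) (Fin (c + 1)) ℝ) - Amat ρ σ c)⁻¹.mulVec
            (fun j => if j = 0 then 1 else 0) m =
          -PpolyStar ρ σ z m +
            (PpolyStar ρ σ z (c + 1) - z * PpolyStar ρ σ z c) /
              (Ppoly ρ σ z (c + 1) - z * Ppoly ρ σ z c) * Ppoly ρ σ z m) ∧
      (z • (1 : Matrix (Fin (c + 1)) (Fin (c + 1)) ℝ) - Amat ρ σ c)⁻¹ 0 0 =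
        (PpolyStar ρ σ z (c + 1) - z * PpolyStar ρ σ z c) /
          (Ppoly ρ σ z (c + 1) - z * Ppoly ρ σ z c) := by
  have hunit : IsUnit (z • (1 : Matrix (Fin (c + 1)) (Fin (c + 1)) ℝ) - Amat ρ σ c) := by
    rw [← Matrix.mulVec_injective_iff_isUnit]
    refine (injective_iff_map_eq_zero
      (z • (1 : Matrix (Fin (c + 1)) (Fin (c + 1)) ℝ) - Amat ρ σ c).mulVecLin).2 fun v hv => ?_
    obtain ⟨f, rfl⟩ : ∃ f : ℕ → ℝ, v = fun j : Fin (c + 1) => f j :=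
      ⟨fun n => if h : n < c + 1 then v ⟨n, h⟩ else 0, by ext j; simp [j.is_le]⟩
    have hrow := fun i => (resolvent_mulVec_apply ρ σ z hc f i).symm.trans (congrFun hv i)
    have hf := eq_mul_Ppoly (z := z) hρ hσ (c := c) (f := f) fun n hn => by
      have := hrow ⟨n, by omega⟩
      simpa [hn, hn.ne] using this
    obtain ⟨k, rfl⟩ : ∃ k, c = k + 1 := ⟨c - 1, by omega⟩
    have hlast := hrow (Fin.last _)
    simp only [Fin.val_last, lt_irrefl, if_false, if_true, Nat.add_sub_cancel, Pi.zero_apply,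
      sub_zero, Nat.cast_add, Nat.cast_one] at hlast
    rw [hf k (by omega), hf (k + 1) le_rfl] at hlast
    have hP := last_row_eq (z := z) hρ hσ k
      (show Ppoly ρ σ z (k + 1 + 1) = _ by rw [Ppoly])
    have hc0 : ρ / ((k : ℝ) + 1 + σ) ≠ 0 := by positivity
    have h0 : f 0 * (ρ / ((k : ℝ) + 1 + σ) *
        (Ppoly ρ σ z (k + 1 + 1) - z * Ppoly ρ σ z (k + 1))) = 0 := by
      rw [← hP]
      linarith
    have hf0 : f 0 = 0 :=
      (mul_eq_zero.1 h0).resolve_right (mul_ne_zero hc0 (sub_ne_zero.2 hz))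
    ext j
    simp [hf j (by omega), hf0]
  set K := (PpolyStar ρ σ z (c + 1) - z * PpolyStar ρ σ z c) /
    (Ppoly ρ σ z (c + 1) - z * Ppoly ρ σ z c)
  have hsol : (z • (1 : Matrix (Fin (c + 1)) (Fin (c + 1)) ℝ) - Amat ρ σ c).mulVec
      (fun j => -PpolyStar ρ σ z j + K * Ppoly ρ σ z j) = fun j => if j = 0 then 1 else 0 := by
    ext i
    rw [resolvent_mulVec_apply ρ σ z hc (fun n => -PpolyStar ρ σ z n + K * Ppoly ρ σ z n)]
    obtain ⟨n, hn⟩ := i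
    rcases n with _ | n
    · have : σ + ρ ≠ 0 := by positivity
      simp [Ppoly, PpolyStar, show 0 < c by omega, show 0 ≠ c by omega]
      field_simp
      ring
    · have hP : Ppoly ρ σ z (n + 2) = (((n : ℝ) + 1 + σ + ρ) * z * Ppoly ρ σ z (n + 1) -
          ((n : ℝ) + 1) * Ppoly ρ σ z n) / ρ := by rw [Ppoly]
      have hS : PpolyStar ρ σ z (n + 2) = (((n : ℝ) + 1 + σ + ρ) * z * PpolyStar ρ σ z (n + 1) -
          ((n : ℝ) + 1) * PpolyStar ρ σ z n) / ρ := by rw [PpolyStar]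
      have h1 : (n : ℝ) + 1 + σ + ρ ≠ 0 := by positivity
      rcases (show n + 1 ≤ c by omega).eq_or_lt with rfl | hlt
      · have hne := sub_ne_zero.2 hz
        have eP := last_row_eq (z := z) hρ hσ n hP
        have eS := last_row_eq (z := z) hρ hσ n hS
        have hKmul : K * (Ppoly ρ σ z (n + 2) - z * Ppoly ρ σ z (n + 1)) =
            PpolyStar ρ σ z (n + 2) - z * PpolyStar ρ σ z (n + 1) := div_mul_cancel₀ _ hne
        simp only [lt_irrefl, if_false, if_true, Nat.add_sub_cancel, sub_zero, Nat.cast_add,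
          Nat.cast_one, Fin.mk_eq_zero, Nat.succ_ne_zero]
        linear_combination K * eP - eS + ρ / ((n : ℝ) + 1 + σ) * hKmul
      · simp only [hlt, hlt.ne, if_false, if_true, Nat.add_sub_cancel, Nat.cast_add,
          Nat.cast_one, Fin.mk_eq_zero, Nat.succ_ne_zero, hP, hS]
        field_simp
        ring
  have hcomp : ∀ m : Fin (c + 1),
      (z • (1 : Matrix (Fin (c + 1)) (Fin (c + 1)) ℝ) - Amat ρ σ c)⁻¹.mulVec
        (fun j => if j = 0 then 1 else 0) m = -PpolyStar ρ σ z m + K * Ppoly ρ σ z m := by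
    intro m
    rw [← hsol, Matrix.mulVec_mulVec,
      Matrix.nonsing_inv_mul _ ((Matrix.isUnit_iff_isUnit_det _).1 hunit), Matrix.one_mulVec]
  refine ⟨hunit, hcomp, ?_⟩
  simpa [Matrix.mulVec, dotProduct, Ppoly, PpolyStar] using hcomp 0
end

section
/- Let ρ > 0 and let c ≥ 1 be an integer. A real number x is an eigenvalue of the matrix B^[c] (i.e., there exists a nonzero vector v ∈ ℝ^{c+1} with B^[c]·v = x·v) if and only if C_{c+1}(−x;ρ) = C_c(−x;ρ). Moreover 0 is an eigenvalue of B^[c], with the all-ones vector as an eigenvector. -/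
/-- The `(c+1)×(c+1)` generator `B^[c]` of the `M/M/c/c` queue with arrival rate `ρ` and unit
service rate: diagonal `−(n+ρ)` for `n < c` and `−c` at `(c,c)`, superdiagonal `ρ`,
subdiagonal `n`. -/
noncomputable def Bmat (ρ : ℝ) (c : ℕ) : Matrix (Fin (c + 1)) (Fin (c + 1)) ℝ :=
  Matrix.of fun i j =>
    if (i : ℕ) = (j : ℕ) then (if (i : ℕ) = c then -(c : ℝ) else -((i : ℕ) + ρ))
    else if (j : ℕ) = (i : ℕ) + 1 then ρ
    else if (j : ℕ) + 1 = (i : ℕ) then (i : ℕ)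
    else 0

/-- The three-term recurrence in division-free form, valid for all `n` (the truncated index at
`n = 0` is harmless because of the factor `n`). -/
lemma charlier_recurrence {a : ℝ} (ha : a ≠ 0) (x : ℝ) (n : ℕ) :
    a * charlier a x (n + 1) = (n + a - x) * charlier a x n - n * charlier a x (n - 1) := by
  cases n with
  | zero => simp [charlier]; field_simp
  | succ k =>
    simp only [charlier, Nat.add_sub_cancel, Nat.cast_add, Nat.cast_one]
    field_simp

/-- The action of `B^[c]` on the restriction of a sequence: the birth-death operator with a
correction in the last row. -/
lemma Bmat_mulVec_apply (ρ : ℝ) (c : ℕ) (w : ℕ → ℝ) (i : Fin (c + 1)) :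
    (Bmat ρ c).mulVec (fun j => w j) i =
      i * w (i - 1) - (i + ρ) * w i + ρ * w (i + 1) +
        if (i : ℕ) = c then ρ * (w c - w (c + 1)) else 0 := by
  obtain ⟨i, hi⟩ := i
  have hsum : (Bmat ρ c).mulVec (fun j => w j) ⟨i, hi⟩ =
      ∑ j ∈ Finset.range (c + 1),
        ((if j = i then (if i = c then -(c : ℝ) else -(i + ρ)) * w i else 0) +
          (if j = i + 1 then ρ * w (i + 1) else 0) +
          (if j = i - 1 then i * w (i - 1) else 0)) := by
    rw [Finset.sum_range]
    simp only [Matrix.mulVec, dotProduct]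
    refine Finset.sum_congr rfl fun j _ => ?_
    obtain ⟨j, hj⟩ := j
    simp only [Bmat, Matrix.of_apply]
    rcases i with _ | k <;> grind
  rw [hsum, Finset.sum_add_distrib, Finset.sum_add_distrib]
  simp only [Finset.sum_ite_eq', Finset.mem_range]
  split_ifs <;> grind

/-- A sequence satisfying the Charlier recurrence below `c` is a multiple of the Charlier
polynomials up to `c`. -/
lemma eq_mul_charlier_of_recurrence {a : ℝ} (ha : a ≠ 0) (x : ℝ) (c : ℕ) (w : ℕ → ℝ)
    (hw : ∀ n < c, a * w (n + 1) = (n + a - x) * w n - n * w (n - 1)) (n : ℕ) (hn : n ≤ c) :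
    w n = w 0 * charlier a x n := by
  induction n using Nat.strong_induction_on with
  | _ n ih =>
    cases n with
    | zero => simp [charlier]
    | succ k =>
      apply mul_left_cancel₀ ha
      rw [hw k (by omega), mul_left_comm, charlier_recurrence ha, ih k (by omega) (by omega),
        ih (k - 1) (by omega) (by omega)]
      ring

/-- `x` is an eigenvalue of `B^[c]` iff `C_{c+1}(−x;ρ) = C_c(−x;ρ)`; moreover `0`
is an eigenvalue with the all-ones vector as eigenvector. -/
theorem eigenvalue_Bmat_iff (ρ : ℝ) (hρ : 0 < ρ) (c : ℕ) (hc : 1 ≤ c) :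
    (∀ x : ℝ,
      (∃ v : Fin (c + 1) → ℝ, v ≠ 0 ∧ (Bmat ρ c).mulVec v = x • v) ↔
        charlier ρ (-x) (c + 1) = charlier ρ (-x) c) ∧
    (Bmat ρ c).mulVec (fun _ => 1) = 0 := by
  have hρ' : ρ ≠ 0 := hρ.ne'
  refine ⟨fun x => ⟨?_, fun h => ?_⟩, ?_⟩
  · rintro ⟨v, hv, hBv⟩
    obtain ⟨w, rfl⟩ : ∃ w : ℕ → ℝ, v = fun j : Fin (c + 1) => w j :=
      ⟨fun n => if h : n < c + 1 then v ⟨n, h⟩ else 0, by ext j; simp [j.is_lt]⟩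
    have hrow : ∀ n, n < c + 1 → n * w (n - 1) - (n + ρ) * w n + ρ * w (n + 1) +
        (if n = c then ρ * (w c - w (c + 1)) else 0) = x * w n := fun n hn => by
      simpa [Bmat_mulVec_apply] using congrFun hBv ⟨n, hn⟩
    have hC := eq_mul_charlier_of_recurrence hρ' (-x) c w fun n hn => by
      have := hrow n (by omega)
      rw [if_neg hn.ne] at this
      linarith
    have hw0 : w 0 ≠ 0 := fun h0 => hv <| by
      ext j
      simp [hC j (by omega), h0]
    have hlast := hrow c (by omega)
    rw [if_pos rfl] at hlast
    apply mul_left_cancel₀ (mul_ne_zero hw0 hρ')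
    have hrec := charlier_recurrence hρ' (-x) c
    have h1 := hC c le_rfl
    have h2 := hC (c - 1) (by omega)
    rw [h2, h1] at hlast
    linear_combination w 0 * hrec - hlast
  · refine ⟨fun j => charlier ρ (-x) j, fun h0 => ?_, ?_⟩
    · simpa [charlier] using congrFun h0 0
    · ext i
      rw [Bmat_mulVec_apply, h, sub_self, mul_zero, ite_self, charlier_recurrence hρ']
      simp only [Pi.smul_apply, smul_eq_mul]
      ring
  · ext i
    rw [Bmat_mulVec_apply ρ c (fun _ => 1)]
    simp
end
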